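/- Let n ≥ 1 and R > 0, and let H : ℝ × ℝ^{2n} → ℝ be a smooth function that is 1-periodic in the first variable (H(t+1,x) = H(t,x)), nonnegative, whose support in the x-variable is contained in a fixed compact subset of the open ball B_R of radius R centered at the origin (uniformly in t), and which satisfies H(t,0) > 0 for all t. Then the time-dependent Hamiltonian flow of H has a 1-periodic orbit with positive action: there exists a solution γ : ℝ → ℝ^{2n} of γ'(t) = J∇_x H(t, γ(t)) with γ(t+1) = γ(t) for all t and A_H(γ) = −(1/2)∫₀¹ ⟨Jγ(t), γ'(t)⟩ dt + ∫₀¹ H(t, γ(t)) dt > 0. -/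

import Mathlib

open scoped RealInnerProductSpace ENNReal NNReal Topology
open Metric Set

noncomputable section

/-- `ℝ^{2n}` identified with `ℂ^n`, with the standard (real) inner product and
the standard complex structure `J` given by multiplication by `i`. -/
abbrev Esp (n : ℕ) := EuclideanSpace ℂ (Fin n)

variable {n : ℕ}

/-- The Hamiltonian vector field `X_H = J ∇H` of `H : ℝ^{2n} → ℝ`. -/
def hamVF (H : Esp n → ℝ) (x : Esp n) : Esp n := Complex.I • gradient H x

/-- A nonconstant `T`-periodic orbit of the Hamiltonian flow of `H`:
a nonconstant solution `γ` of `γ' = J∇H(γ)` with `γ (t + T) = γ t`. -/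
def IsPeriodicOrbit (H : Esp n → ℝ) (γ : ℝ → Esp n) (T : ℝ) : Prop :=
  0 < T ∧ (∀ t, HasDerivAt γ (hamVF H (γ t)) t) ∧
    (∀ t, γ (t + T) = γ t) ∧ ∃ t₀ t₁, γ t₀ ≠ γ t₁

/-- `H` has a fast (period `≤ 1`) nonconstant periodic orbit. -/
def HasFastOrbit (H : Esp n → ℝ) : Prop :=
  ∃ γ T, IsPeriodicOrbit H γ T ∧ T ≤ 1

/-- The symplectic action of a `1`-periodic loop `γ` with respect to the
(possibly time-dependent) Hamiltonian `H`:
`A_H(γ) = -(1/2)∫₀¹ ⟨Jγ(t), γ'(t)⟩ dt + ∫₀¹ H(t, γ(t)) dt`. -/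
def action (H : ℝ → Esp n → ℝ) (γ : ℝ → Esp n) : ℝ :=
  -(1 / 2) * (∫ t in (0:ℝ)..1, ⟪(Complex.I • γ t : Esp n), deriv γ t⟫) +
    ∫ t in (0:ℝ)..1, H t (γ t)

/-- The class `𝓗(V, Z)`: smooth functions on `ℝ^{2n}` with compact support
contained in `V`, constant on a neighborhood of `Z`, whose value on `Z` is the
maximum of `H`. -/
def InHclass (V Z : Set (Esp n)) (H : Esp n → ℝ) : Prop :=
  ContDiff ℝ (⊤ : ℕ∞) H ∧ IsCompact (tsupport H) ∧ tsupport H ⊆ V ∧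
    (∃ U, IsOpen U ∧ Z ⊆ U ∧ ∃ c : ℝ, ∀ x ∈ U, H x = c) ∧
    ∀ z ∈ Z, ∀ x, H x ≤ H z

/-- The relative Hofer–Zehnder capacity `c_HZ(V, Z)`: the supremum of `max H`
over all `H ∈ 𝓗(V, Z)` having no fast nonconstant periodic orbit (for `z ∈ Z`,
`H z = max H`). -/
def relCap (V Z : Set (Esp n)) : ℝ≥0∞ :=
  sSup {c | ∃ H, InHclass V Z H ∧ ¬ HasFastOrbit H ∧
    ∃ z ∈ Z, c = ENNReal.ofReal (H z)}


theorem aux_det_interp (W : Type*) [NormedAddCommGroup W] [NormedSpace ℝ W]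
    [FiniteDimensional ℝ W] (τ : ℝ) (hτ : 0 < τ) :
    ∃ (N : ℕ) (v c : ℕ → ℝ), (∀ i, 0 < v i ∧ v i < τ) ∧
      (∑ i ∈ Finset.range N, c i = 1) ∧
      ∀ A : W →L[ℝ] W, (1 + A).det = ∑ i ∈ Finset.range N, c i * (1 + v i • A).det := by
  classical
  set d := Module.finrank ℝ W
  let b := Module.finBasis ℝ W
  let v : ℕ → ℝ := fun i => τ / (i + 2)
  have hv : Set.InjOn v (Finset.range (d + 1) : Set ℕ) := by
    intro i _ j _ h
    simp only [v] at h
    have h1 : (0:ℝ) < i + 2 := by positivity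
    have h2 : (0:ℝ) < j + 2 := by positivity
    rw [div_eq_div_iff h1.ne' h2.ne'] at h
    have := mul_left_cancel₀ hτ.ne' h
    have h3 : (i:ℝ) = j := by linarith
    exact_mod_cast h3
  let s := Finset.range (d + 1)
  let c : ℕ → ℝ := fun i => (Lagrange.basis s v i).eval 1
  have key : ∀ p : Polynomial ℝ, p.natDegree ≤ d → p.eval 1 = ∑ i ∈ s, c i * p.eval (v i) := by
    intro p hp
    have h1 : p.degree < s.card := by
      simp only [s, Finset.card_range]
      refine lt_of_le_of_lt Polynomial.degree_le_natDegree ?_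
      exact_mod_cast Nat.lt_succ_of_le hp
    have := Lagrange.eq_interpolate hv h1
    conv_lhs => rw [this]
    simp only [Lagrange.interpolate_apply, Polynomial.eval_finsetSum, Polynomial.eval_mul,
      Polynomial.eval_C, c]
    exact Finset.sum_congr rfl fun i _ => mul_comm _ _
  refine ⟨d + 1, v, c, ?_, ?_, ?_⟩
  · intro i
    refine ⟨by positivity, ?_⟩
    rw [div_lt_iff₀ (by positivity)]
    have : (0:ℝ) ≤ i := by positivity
    nlinarith
  · have := key 1 (by simp)
    simpa using this.symm
  · intro A
    let M := LinearMap.toMatrix b b (A : W →ₗ[ℝ] W)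
    let p : Polynomial ℝ := Matrix.det ((Polynomial.X : Polynomial ℝ) • M.map Polynomial.C
      + (1 : Matrix _ _ ℝ).map Polynomial.C)
    have hp : p.natDegree ≤ d := by
      have := Polynomial.natDegree_det_X_add_C_le M 1
      exact this.trans (by simp [d])
    have hdet : ∀ t : ℝ, (1 + t • A).det = p.eval t := by
      intro t
      have h1 : p.eval t = Matrix.det (t • M + 1) := by
        simp only [p]
        rw [← Polynomial.coe_evalRingHom, RingHom.map_det]
        congr 1
        ext i j
        by_cases hij : i = j
        · subst hij
          simp
          ring
        · simp [hij]
          ring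
      rw [h1, ContinuousLinearMap.det, ← LinearMap.det_toMatrix b]
      congr 1
      have : (((1 + t • A : W →L[ℝ] W)) : W →ₗ[ℝ] W) = t • (A : W →ₗ[ℝ] W) + LinearMap.id := by
        ext x; simp [add_comm]
      rw [this, map_add, map_smul, LinearMap.toMatrix_id]
    have := key p hp
    rw [← hdet] at this
    simp only [← hdet, one_smul] at this
    exact this

theorem aux_no_retract {W : Type*} [NormedAddCommGroup W] [InnerProductSpace ℝ W]
    [FiniteDimensional ℝ W] (r : W → W) (hr : ContDiff ℝ 1 r) (ρ : ℝ) (hρ : 0 < ρ)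
    (hid : ∀ x, ‖x‖ = ρ → r x = x) (hn : ∀ x, ‖r x‖ = ρ) : False := by
  classical
  borelize W
  let μ : MeasureTheory.Measure W := MeasureTheory.Measure.addHaar
  let g : W → W := fun x => r x - x
  have hg : ContDiff ℝ 1 g := hr.sub contDiff_id
  -- derivative bound
  obtain ⟨L, hL⟩ : ∃ L : ℝ≥0, ∀ x ∈ closedBall (0:W) ρ, ‖fderiv ℝ g x‖₊ ≤ L := by
    have hc : ContinuousOn (fun x => ‖fderiv ℝ g x‖) (closedBall (0:W) ρ) :=
      ((hg.continuous_fderiv one_ne_zero).norm).continuousOn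
    obtain ⟨C, hC⟩ := (isCompact_closedBall (0:W) ρ).bddAbove_image hc
    refine ⟨Real.toNNReal C, fun x hx => ?_⟩
    rw [← NNReal.coe_le_coe]
    exact (hC (mem_image_of_mem _ hx)).trans (Real.le_coe_toNNReal C)
  have hlip : LipschitzOnWith L g (closedBall (0:W) ρ) :=
    (convex_closedBall (0:W) ρ).lipschitzOnWith_of_nnnorm_fderiv_le
      (fun x _ => (hg.differentiable one_ne_zero) x) hL
  obtain ⟨δ, hδ, hdet⟩ : ∃ δ > 0, ∀ B : W →L[ℝ] W, ‖B‖ < δ → 0 < (1 + B).det := by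
    have hc : Continuous fun B : W →L[ℝ] W => (1 + B).det :=
      ContinuousLinearMap.continuous_det.comp (continuous_const.add continuous_id)
    have h0 : (0:ℝ) < (fun B : W →L[ℝ] W => (1 + B).det) 0 := by
      simp [ContinuousLinearMap.det]
    have := (hc.tendsto 0).eventually (lt_mem_nhds h0)
    obtain ⟨δ, hδ, h⟩ := Metric.eventually_nhds_iff.1 this
    exact ⟨δ, hδ, fun B hB => h (by simpa using hB)⟩
  let τ : ℝ := min (1/2) (min (1/2) (δ/2) / (L + 1))
  have hL1 : (0:ℝ) < L + 1 := by positivity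
  have hτ : 0 < τ := by positivity
  have hτ1 : τ < 1 := lt_of_le_of_lt (min_le_left _ _) (by norm_num)
  have hτL : τ * L ≤ min (1/2) (δ/2) := by
    have h1 : τ ≤ min (1/2) (δ/2) / (L + 1) := min_le_right _ _
    rw [le_div_iff₀ hL1] at h1
    nlinarith
  obtain ⟨N, v, c, hv, hc, hA⟩ := aux_det_interp W τ hτ
  -- the volume identity for small `t`
  have hvol : ∀ t, 0 < t → t < τ →
      MeasureTheory.IntegrableOn (fun x => (1 + t • fderiv ℝ g x).det) (ball (0:W) ρ) μ ∧
      ∫ x in ball (0:W) ρ, (1 + t • fderiv ℝ g x).det ∂μ = μ.real (ball (0:W) ρ) := by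
    intro t ht htτ
    have htL : t * L ≤ min (1/2) (δ/2) := (mul_le_mul_of_nonneg_right htτ.le L.2).trans hτL
    have ht1 : t < 1 := htτ.trans hτ1
    let F : W → W := fun x => x + t • g x
    have hFr : ∀ x, F x = (1 - t) • x + t • r x := by
      intro x; simp only [F, g]; module
    have hFd : ∀ x, HasFDerivAt F (1 + t • fderiv ℝ g x) x := by
      intro x
      exact (hasFDerivAt_id x).add
        (((hg.differentiable one_ne_zero) x).hasFDerivAt.const_smul t)
    have hFc : Continuous F := continuous_id.add (hg.continuous.const_smul t)
    have happ : ApproximatesLinearOn F ((ContinuousLinearEquiv.refl ℝ W : W ≃L[ℝ] W) : W →L[ℝ] W)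
        (closedBall (0:W) ρ) (1/2 : ℝ≥0) := by
      intro x hx y hy
      have h1 := hlip.norm_sub_le hx hy
      have h2 : F x - F y - ((ContinuousLinearEquiv.refl ℝ W : W ≃L[ℝ] W) : W →L[ℝ] W) (x - y)
          = t • (g x - g y) := by
        simp only [F, ContinuousLinearEquiv.coe_refl, ContinuousLinearMap.coe_id', id]
        module
      rw [h2, norm_smul, Real.norm_of_nonneg ht.le]
      have h3 : t * L ≤ 1/2 := htL.trans (min_le_left _ _)
      push_cast
      calc t * ‖g x - g y‖ ≤ t * (L * ‖x - y‖) := by gcongr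
        _ = (t * L) * ‖x - y‖ := by ring
        _ ≤ 1/2 * ‖x - y‖ := by gcongr
    have hinj : InjOn F (closedBall (0:W) ρ) := by
      intro x hx y hy hxy
      have h1 := happ x hx y hy
      rw [hxy] at h1
      simp only [sub_self, zero_sub, norm_neg, ContinuousLinearEquiv.coe_refl,
        ContinuousLinearMap.coe_id', id] at h1
      push_cast at h1
      have h2 : ‖x - y‖ ≤ 0 := by linarith [norm_nonneg (x - y)]
      exact sub_eq_zero.1 (norm_le_zero_iff.1 h2)
    have hopen : IsOpen (F '' ball (0:W) ρ) := by
      rcases subsingleton_or_nontrivial W with hs | hs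
      · exact isOpen_discrete _
      refine (happ.mono_set ball_subset_closedBall).open_image
        (ContinuousLinearEquiv.toNonlinearRightInverse (ContinuousLinearEquiv.refl ℝ W)) isOpen_ball (Or.inr ?_)
      change (1/2 : ℝ≥0) < ‖((ContinuousLinearEquiv.refl ℝ W).symm : W →L[ℝ] W)‖₊⁻¹
      have : ‖((ContinuousLinearEquiv.refl ℝ W).symm : W →L[ℝ] W)‖₊ = 1 := by
        ext
        simp
      rw [this, inv_one]
      exact NNReal.half_lt_self one_ne_zero
    have hmaps : F '' ball (0:W) ρ ⊆ ball (0:W) ρ := by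
      rintro _ ⟨x, hx, rfl⟩
      rw [mem_ball_zero_iff] at hx ⊢
      rw [hFr]
      calc ‖(1 - t) • x + t • r x‖ ≤ (1 - t) * ‖x‖ + t * ‖r x‖ := by
            refine (norm_add_le _ _).trans ?_
            rw [norm_smul, norm_smul, Real.norm_of_nonneg ht.le, Real.norm_of_nonneg (by linarith)]
        _ < ρ := by rw [hn]; nlinarith
    have himg : F '' ball (0:W) ρ = ball (0:W) ρ := by
      have hclosed : IsClosed (F '' closedBall (0:W) ρ) :=
        ((isCompact_closedBall (0:W) ρ).image hFc).isClosed
      have heq : F '' closedBall (0:W) ρ ∩ ball (0:W) ρ ⊆ F '' ball (0:W) ρ := by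
        rintro _ ⟨⟨x, hx, rfl⟩, hx2⟩
        rcases (mem_closedBall_zero_iff.1 hx).lt_or_eq with h | h
        · exact ⟨x, mem_ball_zero_iff.2 h, rfl⟩
        · exfalso
          have : F x = x := by simp [F, g, hid x h]
          rw [this, mem_ball_zero_iff] at hx2
          linarith
      refine hmaps.antisymm ?_
      have hconn : IsPreconnected (ball (0:W) ρ) := (convex_ball (0:W) ρ).isPreconnected
      refine hconn.subset_left_of_subset_union hopen hclosed.isOpen_compl ?_ ?_ ?_
      · rw [Set.disjoint_left]
        intro y hy hy2
        exact hy2 (image_mono ball_subset_closedBall hy)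
      · intro y hy
        by_cases h : y ∈ F '' closedBall (0:W) ρ
        · exact Or.inl (heq ⟨h, hy⟩)
        · exact Or.inr h
      · exact ⟨F 0, hmaps ⟨0, by simpa using hρ, rfl⟩, ⟨0, by simpa using hρ, rfl⟩⟩
    have hcont : Continuous (fun x => (1 + t • fderiv ℝ g x).det) :=
      ContinuousLinearMap.continuous_det.comp
        (continuous_const.add ((hg.continuous_fderiv one_ne_zero).const_smul t))
    have hinteg : MeasureTheory.IntegrableOn (fun x => (1 + t • fderiv ℝ g x).det)
        (ball (0:W) ρ) μ :=
      (hcont.continuousOn.integrableOn_compact (isCompact_closedBall (0:W) ρ)).mono_set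
        ball_subset_closedBall
    refine ⟨hinteg, ?_⟩
    have hpos : ∀ x ∈ ball (0:W) ρ, 0 < (1 + t • fderiv ℝ g x).det := by
      intro x hx
      apply hdet
      rw [norm_smul, Real.norm_of_nonneg ht.le]
      have := hL x (ball_subset_closedBall hx)
      have h2 : ‖fderiv ℝ g x‖ ≤ L := this
      calc t * ‖fderiv ℝ g x‖ ≤ t * L := by gcongr
        _ ≤ δ / 2 := htL.trans (min_le_right _ _)
        _ < δ := by linarith
    have hJ := MeasureTheory.lintegral_abs_det_fderiv_eq_addHaar_image μ
      (measurableSet_ball (x := (0:W)) (ε := ρ))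
      (fun x _ => (hFd x).hasFDerivWithinAt) (hinj.mono ball_subset_closedBall)
    rw [himg] at hJ
    rw [MeasureTheory.integral_eq_lintegral_of_nonneg_ae _ hcont.aestronglyMeasurable]
    · rw [MeasureTheory.measureReal_def, ← hJ]
      congr 1
      refine MeasureTheory.setLIntegral_congr_fun measurableSet_ball fun x hx => ?_
      simp only [abs_of_pos (hpos x hx)]
    · exact (MeasureTheory.ae_restrict_mem measurableSet_ball).mono fun x hx => (hpos x hx).le
  have hzero : ∀ x, (1 + fderiv ℝ g x).det = 0 := by
    intro x
    have h1 : HasFDerivAt r (1 + fderiv ℝ g x) x := by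
      have := (hasFDerivAt_id x).add ((hg.differentiable one_ne_zero) x).hasFDerivAt
      refine this.congr_of_eventuallyEq (Filter.Eventually.of_forall fun y => ?_)
      simp [g]
    by_contra hne
    have h2 := h1.norm_sq
    have h3 : (fun y => ‖r y‖ ^ 2) = fun _ => ρ ^ 2 := by ext y; rw [hn]
    rw [h3] at h2
    have h4 := h2.unique (hasFDerivAt_const (ρ ^ 2) x)
    have hsurj : Function.Surjective ((1 + fderiv ℝ g x : W →L[ℝ] W)) :=
      (ContinuousLinearMap.toContinuousLinearEquivOfDetNeZero _ hne).surjective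
    obtain ⟨w, hw⟩ := hsurj (r x)
    have h5 := DFunLike.congr_fun h4 w
    generalize (1 + fderiv ℝ g x : W →L[ℝ] W) = T at hw h5
    simp [hw] at h5
    have := hn x
    rw [h5] at this
    simp at this
    linarith
  have hfin : ∫ x in ball (0:W) ρ, (1 + fderiv ℝ g x).det ∂μ = μ.real (ball (0:W) ρ) := by
    rw [show (fun x => (1 + fderiv ℝ g x).det) = fun x => ∑ i ∈ Finset.range N,
      c i * (1 + v i • fderiv ℝ g x).det from funext fun x => hA _]
    rw [MeasureTheory.integral_finsetSum]
    · simp only [MeasureTheory.integral_const_mul]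
      rw [Finset.sum_congr rfl fun i _ => by rw [(hvol (v i) (hv i).1 (hv i).2).2]]
      rw [← Finset.sum_mul, hc, one_mul]
    · intro i _
      exact (hvol (v i) (hv i).1 (hv i).2).1.const_mul _
  simp only [hzero, MeasureTheory.integral_zero] at hfin
  have hpos : 0 < μ.real (ball (0:W) ρ) := by
    rw [MeasureTheory.measureReal_def]
    exact ENNReal.toReal_pos (measure_ball_pos μ _ hρ).ne' MeasureTheory.measure_ball_lt_top.ne
  linarith

theorem aux_brouwer {W : Type*} [NormedAddCommGroup W] [InnerProductSpace ℝ W]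
    [FiniteDimensional ℝ W] (h : W → W) (hh : ContDiff ℝ 1 h) (ρ : ℝ) (hρ : 0 < ρ)
    (hid : ∀ x, ρ ≤ ‖x‖ → h x = x) : ∃ x, h x = 0 := by
  by_contra! hne
  refine aux_no_retract (fun x => (ρ * ‖h x‖⁻¹) • h x) ?_ ρ hρ ?_ ?_
  · have : ContDiff ℝ 1 fun x => ‖h x‖ := hh.norm ℝ hne
    exact (contDiff_const.mul (this.inv fun x => norm_ne_zero_iff.2 (hne x))).smul hh
  · intro x hx
    rw [hid x hx.ge, hx, mul_inv_cancel₀ hρ.ne', one_smul]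
  · intro x
    rw [norm_smul, norm_mul, norm_inv, norm_norm, mul_assoc,
      inv_mul_cancel₀ (norm_ne_zero_iff.2 (hne x)), mul_one, Real.norm_of_nonneg hρ.le]
theorem aux_saddle {E W : Type*} [NormedAddCommGroup E] [InnerProductSpace ℝ E]
    [FiniteDimensional ℝ E] [NormedAddCommGroup W] [InnerProductSpace ℝ W]
    [FiniteDimensional ℝ W] (ι : W →L[ℝ] E) (P : E →L[ℝ] W) (hP : ∀ w, P (ι w) = w)
    (f : E → ℝ) (G : E → E) (hG : ∀ x, HasGradientAt f (G x) x) (hG1 : ContDiff ℝ 1 G)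
    (L : ℝ) (hL : ∀ x y, ‖G x - G y‖ ≤ L * ‖x - y‖)
    (β C ρ : ℝ) (hβ : 0 < β) (hρ : 0 < ρ)
    (hlow : ∀ x, P x = 0 → β ≤ f x)
    (hbd : ∀ w, ρ ≤ ‖w‖ → f (ι w) ≤ β / 2)
    (hup : ∀ w, f (ι w) ≤ C) (ε : ℝ) (hε : 0 < ε) :
    ∃ x, β ≤ f x ∧ f x ≤ C ∧ ‖G x‖ ≤ ε := by
  by_contra! hcon
  have hf1 : ContDiff ℝ 1 f := by
    rw [contDiff_one_iff_fderiv]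
    refine ⟨fun x => (hG x).differentiableAt, ?_⟩
    have : fderiv ℝ f = fun x => (InnerProductSpace.toDual ℝ E) (G x) := by
      ext1 x
      exact (hG x).hasFDerivAt.fderiv
    rw [this]
    exact (LinearIsometryEquiv.continuous _).comp hG1.continuous
  let τ : ℝ := 1 / (2 * (|L| + 1))
  have hτ : 0 < τ := by positivity
  have hτL : τ * |L| ≤ 1 / 2 := by
    simp only [τ]
    rw [div_mul_eq_mul_div, div_le_div_iff₀ (by positivity) (by positivity)]
    nlinarith [abs_nonneg L]
  have hL' : ∀ x y, ‖G x - G y‖ ≤ |L| * ‖x - y‖ := fun x y =>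
    (hL x y).trans (by gcongr; exact le_abs_self L)
  have hdesc : ∀ x s, 0 ≤ s → s ≤ τ → f (x - s • G x) ≤ f x - s / 2 * ‖G x‖ ^ 2 := by
    intro x s hs hsτ
    let φ : ℝ → ℝ := fun u => f (x - u • G x)
    have hφ : ∀ u, HasDerivAt φ (-⟪G (x - u • G x), G x⟫) u := by
      intro u
      have h1 : HasDerivAt (fun u : ℝ => x - u • G x) (-G x) u := by
        simpa using ((hasDerivAt_id u).smul_const (G x)).const_sub x
      have h2 := (hG (x - u • G x)).hasFDerivAt.comp_hasDerivAt u h1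
      have h3 : (InnerProductSpace.toDual ℝ E) (G (x - u • G x)) (-G x)
          = -⟪G (x - u • G x), G x⟫ := by simp
      rw [← h3]
      exact h2
    have hle : ∀ u ∈ interior (Icc (0:ℝ) τ), deriv φ u ≤ -(1/2) * ‖G x‖ ^ 2 := by
      intro u hu
      rw [interior_Icc] at hu
      rw [(hφ u).deriv]
      have h1 : ⟪G x - G (x - u • G x), G x⟫ ≤ 1/2 * ‖G x‖ ^ 2 := by
        calc ⟪G x - G (x - u • G x), G x⟫ ≤ ‖G x - G (x - u • G x)‖ * ‖G x‖ :=
              real_inner_le_norm _ _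
          _ ≤ (|L| * ‖x - (x - u • G x)‖) * ‖G x‖ := by gcongr; exact hL' _ _
          _ = (u * |L|) * ‖G x‖ ^ 2 := by
              rw [sub_sub_cancel, norm_smul, Real.norm_of_nonneg hu.1.le]; ring
          _ ≤ (τ * |L|) * ‖G x‖ ^ 2 := by gcongr; exact hu.2.le
          _ ≤ 1/2 * ‖G x‖ ^ 2 := by gcongr
      rw [inner_sub_left, real_inner_self_eq_norm_sq] at h1
      linarith
    have := (convex_Icc (0:ℝ) τ).image_sub_le_mul_sub_of_deriv_le
      (fun u _ => (hφ u).continuousAt.continuousWithinAt)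
      (fun u _ => (hφ u).differentiableAt.differentiableWithinAt) hle
      0 ⟨le_rfl, hτ.le⟩ s ⟨hs, hsτ⟩ hs
    simp only [φ, zero_smul, sub_zero] at this
    linarith
  let η : E → ℝ := fun x => Real.smoothTransition ((f x - β / 2) / (β / 2))
  have hη0 : ∀ x, 0 ≤ η x := fun x => Real.smoothTransition.nonneg _
  have hη1 : ∀ x, η x ≤ 1 := fun x => Real.smoothTransition.le_one _
  have hηz : ∀ x, f x ≤ β / 2 → η x = 0 := fun x hx =>
    Real.smoothTransition.zero_of_nonpos (div_nonpos_of_nonpos_of_nonneg (by linarith) (by linarith))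
  have hηo : ∀ x, β ≤ f x → η x = 1 := fun x hx =>
    Real.smoothTransition.one_of_one_le (by rw [le_div_iff₀ (by linarith)]; linarith)
  have hηc : ContDiff ℝ 1 η :=
    Real.smoothTransition.contDiff.comp ((hf1.sub contDiff_const).div_const _)
  let ψ : E → E := fun x => x - (τ * η x) • G x
  have hψc : ContDiff ℝ 1 ψ := contDiff_id.sub ((contDiff_const.mul hηc).smul hG1)
  have hψd : ∀ x, f (ψ x) ≤ f x - (τ * η x) / 2 * ‖G x‖ ^ 2 := fun x =>
    hdesc x _ (mul_nonneg hτ.le (hη0 x)) (mul_le_of_le_one_right hτ.le (hη1 x))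
  have hψm : ∀ x, f (ψ x) ≤ f x := fun x => (hψd x).trans (by
    have := mul_nonneg (div_nonneg (mul_nonneg hτ.le (hη0 x)) zero_le_two) (sq_nonneg ‖G x‖)
    linarith)
  have hψid : ∀ x, f x ≤ β / 2 → ψ x = x := fun x hx => by simp [ψ, hηz x hx]
  have hitc : ∀ N : ℕ, ContDiff ℝ 1 (ψ^[N]) := by
    intro N
    induction N with
    | zero => exact contDiff_id
    | succ k ih => rw [Function.iterate_succ]; exact ih.comp hψc
  have hitid : ∀ (N : ℕ) x, f x ≤ β / 2 → ψ^[N] x = x := fun N x hx =>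
    Function.iterate_fixed (hψid x hx) N
  obtain ⟨N, hN⟩ := exists_nat_gt ((C - β) / (τ / 2 * ε ^ 2))
  rw [div_lt_iff₀ (by positivity)] at hN
  obtain ⟨w, hw⟩ := aux_brouwer (fun w : W => P (ψ^[N] (ι w)))
    (P.contDiff.comp ((hitc N).comp ι.contDiff)) ρ hρ
    (fun w hw => by simp only [hitid N _ (hbd w hw), hP])
  have hend := hlow _ hw
  have key : ∀ j ≤ N, β ≤ f (ψ^[j] (ι w)) → f (ψ^[j] (ι w)) ≤ C - j * (τ / 2 * ε ^ 2) := by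
    intro j
    induction j with
    | zero => intro _ _; simpa using hup w
    | succ k ih =>
      intro hk hb
      rw [Function.iterate_succ_apply'] at hb ⊢
      have hb' := hb.trans (hψm _)
      have h1 := ih (by omega) hb'
      have h2 := hψd (ψ^[k] (ι w))
      have hpos : (0:ℝ) ≤ k * (τ / 2 * ε ^ 2) := by positivity
      have h3 := hcon _ hb' (by linarith)
      rw [hηo _ hb'] at h2
      have h4 : ε ^ 2 ≤ ‖G (ψ^[k] (ι w))‖ ^ 2 := by gcongr
      have h5 : τ / 2 * ε ^ 2 ≤ τ / 2 * ‖G (ψ^[k] (ι w))‖ ^ 2 := by gcongr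
      push_cast
      linarith
  have := key N le_rfl hend
  linarith

theorem aux_param {E F : Type*} [NormedAddCommGroup E] [NormedSpace ℝ E] [FiniteDimensional ℝ E]
    [NormedAddCommGroup F] [NormedSpace ℝ F] [CompleteSpace F]
    (u : ℝ → E → F) (hu : ContDiff ℝ 1 (fun p : ℝ × E => u p.1 p.2)) :
    (∀ a, HasFDerivAt (fun a => ∫ t in (0:ℝ)..1, u t a)
      (∫ t in (0:ℝ)..1, fderiv ℝ (u t) a) a) ∧
    ContDiff ℝ 1 (fun a => ∫ t in (0:ℝ)..1, u t a) := by
  have hfd : Continuous (fun p : ℝ × E => fderiv ℝ (u p.1) p.2) := by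
    have h : ContDiff ℝ 1 (Function.uncurry fun (p : ℝ × E) (x : E) => u p.1 x) := by
      exact hu.comp ((contDiff_fst.comp contDiff_fst).prodMk contDiff_snd)
    exact (ContDiff.fderiv (m := 1) (n := 0) h contDiff_snd (by simp)).continuous
  have huc : Continuous (fun p : ℝ × E => u p.1 p.2) := hu.continuous
  have hd : ∀ t a, HasFDerivAt (u t) (fderiv ℝ (u t) a) a := by
    intro t a
    have : ContDiff ℝ 1 (u t) := hu.comp (contDiff_prodMk_right t)
    exact ((this.differentiable one_ne_zero) a).hasFDerivAt
  have h1 : ∀ a, HasFDerivAt (fun a => ∫ t in (0:ℝ)..1, u t a)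
      (∫ t in (0:ℝ)..1, fderiv ℝ (u t) a) a := by
    intro a
    obtain ⟨C, hC⟩ := ((isCompact_Icc (a := (0:ℝ)) (b := 1)).prod
      (isCompact_closedBall a 1)).bddAbove_image hfd.norm.continuousOn
    refine intervalIntegral.hasFDerivAt_integral_of_dominated_of_fderiv_le
      (F := fun a t => u t a) (F' := fun a t => fderiv ℝ (u t) a) (bound := fun _ => C)
      (ball_mem_nhds a one_pos) ?_ ?_ ?_ ?_ ?_ ?_
    · exact Filter.Eventually.of_forall fun x =>
        (huc.comp (continuous_id.prodMk continuous_const)).aestronglyMeasurable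
    · exact (huc.comp (continuous_id.prodMk continuous_const)).intervalIntegrable _ _
    · exact (hfd.comp (continuous_id.prodMk continuous_const)).aestronglyMeasurable
    · refine Filter.Eventually.of_forall fun t ht x hx => hC ⟨(t, x), ⟨?_, ball_subset_closedBall hx⟩, rfl⟩
      rw [uIoc_of_le zero_le_one] at ht
      exact ⟨ht.1.le, ht.2⟩
    · exact intervalIntegrable_const
    · exact Filter.Eventually.of_forall fun t _ x _ => hd t x
  refine ⟨h1, ?_⟩
  rw [contDiff_one_iff_fderiv]
  refine ⟨fun a => (h1 a).differentiableAt, ?_⟩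
  rw [show fderiv ℝ (fun a => ∫ t in (0:ℝ)..1, u t a) = fun a => ∫ t in (0:ℝ)..1, fderiv ℝ (u t) a
    from funext fun a => (h1 a).fderiv]
  exact intervalIntegral.continuous_parametric_intervalIntegral_of_continuous'
    (f := fun a t => fderiv ℝ (u t) a)
    (hfd.comp (continuous_snd.prodMk continuous_fst)) 0 1

theorem aux_grad_zero (H : Esp n → ℝ) (K : Set (Esp n)) (hK : IsClosed K)
    (h : ∀ x ∉ K, H x = 0) (x : Esp n) (hx : x ∉ K) : gradient H x = 0 := by
  have h1 : H =ᶠ[𝓝 x] fun _ => (0:ℝ) := by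
    filter_upwards [hK.isOpen_compl.mem_nhds hx] with y hy using h y hy
  have h2 : fderiv ℝ H x = 0 := by
    rw [h1.fderiv_eq]; simp
  rw [gradient, h2, map_zero]

theorem aux_ham (R : ℝ) (hR : 0 < R)
    (H : ℝ → Esp n → ℝ)
    (hsm : ContDiff ℝ (⊤ : ℕ∞) (fun p : ℝ × Esp n => H p.1 p.2))
    (hper : ∀ t x, H (t + 1) x = H t x)
    (hnonneg : ∀ t x, 0 ≤ H t x)
    (hsupp : ∃ K : Set (Esp n), IsCompact K ∧ K ⊆ ball (0 : Esp n) R ∧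
      ∀ t, ∀ x ∉ K, H t x = 0)
    (h0 : ∀ t, 0 < H t 0) :
    ∃ g : ℝ → Esp n → Esp n, (∀ t x, g t x = gradient (H t) x) ∧
      ContDiff ℝ 1 (fun p : ℝ × Esp n => g p.1 p.2) ∧
      (∀ t x, HasGradientAt (H t) (g t x) x) ∧
      (∀ t x, g (t + 1) x = g t x) ∧
      (∀ t x, R ≤ ‖x‖ → H t x = 0 ∧ g t x = 0) ∧
      (∃ C, 0 < C ∧ ∀ t x, H t x ≤ C) ∧
      (∃ M, 0 < M ∧ ∀ t x, ‖g t x‖ ≤ M) ∧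
      (∃ L, 0 < L ∧ ∀ t x y, ‖g t x - g t y‖ ≤ L * ‖x - y‖) ∧
      (∃ β, 0 < β ∧ ∀ t x, β ≤ Real.pi * ‖x‖ ^ 2 + H t x) := by
  obtain ⟨K, hK, hKR, hKz⟩ := hsupp
  have hHper : Function.Periodic H 1 := fun t => funext fun x => hper t x
  have hfr : ∀ t, H t = H (Int.fract t) := by
    intro t
    have h := hHper.sub_zsmul_eq (x := t) ⌊t⌋
    rw [zsmul_one] at h
    exact h.symm
  have hfrm : ∀ t : ℝ, Int.fract t ∈ Icc (0:ℝ) 1 := fun t =>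
    ⟨Int.fract_nonneg t, (Int.fract_lt_one t).le⟩
  have hnK : ∀ x : Esp n, R ≤ ‖x‖ → x ∉ K := fun x hx hxK => by
    have := hKR hxK
    rw [mem_ball_zero_iff] at this
    linarith
  have hsm2 : ContDiff ℝ 2 (fun p : ℝ × Esp n => H p.1 p.2) := hsm.of_le (by norm_cast)
  let g : ℝ → Esp n → Esp n := fun t x => gradient (H t) x
  have hg1 : ContDiff ℝ 1 (fun p : ℝ × Esp n => g p.1 p.2) := by
    have h : ContDiff ℝ 2 (Function.uncurry fun (p : ℝ × Esp n) (x : Esp n) => H p.1 x) :=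
      hsm2.comp ((contDiff_fst.comp contDiff_fst).prodMk contDiff_snd)
    have h2 : ContDiff ℝ 1 (fun p : ℝ × Esp n => fderiv ℝ (H p.1) p.2) :=
      ContDiff.fderiv (m := 2) (n := 1) h contDiff_snd (by norm_num)
    exact (InnerProductSpace.toDual ℝ (Esp n)).symm.toContinuousLinearEquiv.contDiff.comp h2
  have hgz : ∀ t x, R ≤ ‖x‖ → g t x = 0 := fun t x hx =>
    aux_grad_zero (H t) K hK.isClosed (hKz t) x (hnK x hx)
  have hgfr : ∀ t, g t = g (Int.fract t) := fun t => by
    funext x; simp only [g]; rw [hfr t]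
  have bound : ∀ {F : Type} [NormedAddCommGroup F] (u : ℝ → Esp n → F),
      Continuous (fun p : ℝ × Esp n => u p.1 p.2) → (∀ t, u t = u (Int.fract t)) →
      (∀ t x, R < ‖x‖ → u t x = 0) → ∃ C, 0 < C ∧ ∀ t x, ‖u t x‖ ≤ C := by
    intro F _ u hu hut huz
    obtain ⟨C, hC⟩ := ((isCompact_Icc (a := (0:ℝ)) (b := 1)).prod
      (isCompact_closedBall (0 : Esp n) R)).bddAbove_image hu.norm.continuousOn
    refine ⟨max C 1, by positivity, fun t x => ?_⟩
    by_cases hx : R < ‖x‖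
    · rw [huz t x hx, norm_zero]; positivity
    · rw [hut t]
      exact (hC ⟨(Int.fract t, x), ⟨hfrm t, by simpa using hx⟩, rfl⟩).trans (le_max_left _ _)
  refine ⟨g, fun _ _ => rfl, hg1, ?_, ?_, ?_, ?_, ?_, ?_, ?_⟩
  · intro t x
    have : ContDiff ℝ 2 (H t) := hsm2.comp (contDiff_prodMk_right t)
    exact ((this.differentiable two_ne_zero) x).hasGradientAt
  · intro t x
    simp only [g]; rw [hHper t]
  · exact fun t x hx => ⟨hKz t x (hnK x hx), hgz t x hx⟩
  · obtain ⟨C, hC, h⟩ := bound H hsm.continuous hfr (fun t x hx => hKz t x (hnK x hx.le))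
    exact ⟨C, hC, fun t x => (le_abs_self _).trans (h t x)⟩
  · exact bound g hg1.continuous hgfr (fun t x hx => hgz t x hx.le)
  · have hfd : Continuous (fun p : ℝ × Esp n => fderiv ℝ (g p.1) p.2) := by
      have h : ContDiff ℝ 1 (Function.uncurry fun (p : ℝ × Esp n) (x : Esp n) => g p.1 x) :=
        hg1.comp ((contDiff_fst.comp contDiff_fst).prodMk contDiff_snd)
      exact (ContDiff.fderiv (m := 1) (n := 0) h contDiff_snd (by simp)).continuous
    obtain ⟨L, hL, h⟩ := bound (fun t x => fderiv ℝ (g t) x) hfd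
      (fun t => by funext x; rw [hgfr t]) (fun t x hx => by
        have h1 : g t =ᶠ[𝓝 x] fun _ => (0 : Esp n) := by
          filter_upwards [(isOpen_lt continuous_const continuous_norm).mem_nhds hx] with y hy
            using hgz t y (le_of_lt hy)
        rw [h1.fderiv_eq]; simp)
    refine ⟨L, hL, fun t x y => ?_⟩
    have hgt : ContDiff ℝ 1 (g t) := hg1.comp (contDiff_prodMk_right t)
    exact Convex.norm_image_sub_le_of_norm_fderiv_le (𝕜 := ℝ) (f := g t) (s := univ)
      (fun z _ => (hgt.differentiable one_ne_zero) z) (fun z _ => h t z) convex_univ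
      (mem_univ y) (mem_univ x)
  · let q : ℝ × Esp n → ℝ := fun p => Real.pi * ‖p.2‖ ^ 2 + H p.1 p.2
    have hq : Continuous q := by
      have := hsm.continuous
      fun_prop
    have hqpos : ∀ p, 0 < q p := by
      intro p
      by_cases hp : p.2 = 0
      · have := h0 p.1
        simp only [q, hp]; simpa using this
      · have h1 := hnonneg p.1 p.2
        have h2 : 0 < ‖p.2‖ := norm_pos_iff.2 hp
        have h3 : 0 < Real.pi * ‖p.2‖ ^ 2 := by positivity
        simp only [q]; linarith
    obtain ⟨p, hp, hmin⟩ := ((isCompact_Icc (a := (0:ℝ)) (b := 1)).prod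
      (isCompact_closedBall (0 : Esp n) 1)).exists_isMinOn
      ⟨(0, 0), by simp⟩ hq.continuousOn
    refine ⟨min (q p) 1, lt_min (hqpos p) one_pos, fun t x => ?_⟩
    by_cases hx : ‖x‖ ≤ 1
    · refine (min_le_left _ _).trans ?_
      rw [hfr t]
      exact hmin (a := (Int.fract t, x)) ⟨hfrm t, by simpa using hx⟩
    · refine (min_le_right _ _).trans ?_
      have h1 := hnonneg t x
      have h2 : 1 ≤ ‖x‖ ^ 2 := by nlinarith
      nlinarith [Real.pi_gt_three]

theorem aux_inner_eq (x y : Esp n) : ⟪x, y⟫ = (inner ℂ x y).re := by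
  simp only [PiLp.inner_apply, Complex.re_sum]
  rfl

theorem aux_inner_smul (c : ℂ) (x y : Esp n) :
    ⟪c • x, y⟫ = ⟪x, (starRingEnd ℂ c) • y⟫ := by
  rw [aux_inner_eq, aux_inner_eq, inner_smul_left, inner_smul_right]

theorem aux_inner_J (x y : Esp n) :
    ⟪Complex.I • x, Complex.I • y⟫ = ⟪x, y⟫ := by
  rw [aux_inner_smul, smul_smul]; simp

/-- The exponential `e^{2π i k t}`. -/
def eexp (k : ℤ) (t : ℝ) : ℂ := Complex.exp ((2 * Real.pi * k * t : ℝ) * Complex.I)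

theorem eexp_contDiff (k : ℤ) : ContDiff ℝ 1 (eexp k) := by
  unfold eexp
  have h : ContDiff ℝ 1 (fun t : ℝ => ((2 * Real.pi * k * t : ℝ) : ℂ)) :=
    Complex.ofRealCLM.contDiff.comp (contDiff_const.mul contDiff_id)
  exact (h.mul contDiff_const).cexp

theorem eexp_continuous (k : ℤ) : Continuous (eexp k) := (eexp_contDiff k).continuous

theorem eexp_norm (k : ℤ) (t : ℝ) : ‖eexp k t‖ = 1 := Complex.norm_exp_ofReal_mul_I _

theorem eexp_conj (k : ℤ) (t : ℝ) : (starRingEnd ℂ) (eexp k t) = eexp (-k) t := by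
  unfold eexp
  rw [← Complex.exp_conj, map_mul, Complex.conj_ofReal, Complex.conj_I]
  congr 1
  push_cast
  ring

theorem eexp_mul (k l : ℤ) (t : ℝ) : eexp k t * eexp l t = eexp (k + l) t := by
  unfold eexp
  rw [← Complex.exp_add]
  congr 1
  push_cast
  ring

theorem eexp_zero (t : ℝ) : eexp 0 t = 1 := by simp [eexp]

theorem eexp_at_zero (k : ℤ) : eexp k 0 = 1 := by simp [eexp]

theorem eexp_periodic (k : ℤ) (t : ℝ) : eexp k (t + 1) = eexp k t := by
  unfold eexp
  rw [Complex.exp_eq_exp_iff_exists_int]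
  refine ⟨k, ?_⟩
  push_cast
  ring

theorem eexp_hasDerivAt (k : ℤ) (t : ℝ) :
    HasDerivAt (eexp k) ((2 * Real.pi * k : ℝ) • (Complex.I * eexp k t)) t := by
  have h1 : HasDerivAt (fun t : ℝ => ((2 * Real.pi * k * t : ℝ) : ℂ) * Complex.I)
      (((2 * Real.pi * k : ℝ) : ℂ) * Complex.I) t := by
    have : HasDerivAt (fun t : ℝ => 2 * Real.pi * k * t) (2 * Real.pi * k) t := by
      simpa using (hasDerivAt_id t).const_mul (2 * Real.pi * (k:ℝ))
    exact this.ofReal_comp.mul_const _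
  have h2 := h1.cexp
  have h3 : (2 * Real.pi * k : ℝ) • (Complex.I * eexp k t) =
      Complex.exp (((2 * Real.pi * k * t : ℝ) : ℂ) * Complex.I) *
        (((2 * Real.pi * k : ℝ) : ℂ) * Complex.I) := by
    rw [Complex.real_smul, eexp]
    ring
  rw [h3]
  exact h2

theorem eexp_integral (k : ℤ) : ∫ t in (0:ℝ)..1, eexp k t = if k = 0 then 1 else 0 := by
  split_ifs with h
  · subst h; simp [eexp_zero]
  · have h1 : ∫ t in (0:ℝ)..1, (2 * Real.pi * k : ℝ) • (Complex.I * eexp k t) =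
        eexp k 1 - eexp k 0 := by
      apply intervalIntegral.integral_eq_sub_of_hasDerivAt (fun t _ => eexp_hasDerivAt k t)
      have hc : Continuous fun t => (2 * Real.pi * k : ℝ) • (Complex.I * eexp k t) := by
        have := eexp_continuous k
        fun_prop
      exact hc.intervalIntegrable _ _
    have h2 : eexp k 1 = eexp k 0 := by simpa using eexp_periodic k 0
    rw [h2, sub_self, intervalIntegral.integral_smul, intervalIntegral.integral_const_mul] at h1
    have h3 : (2 * Real.pi * k : ℝ) ≠ 0 := by
      have := Real.pi_ne_zero
      have : (k:ℝ) ≠ 0 := by exact_mod_cast h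
      positivity
    simpa [h, Real.pi_ne_zero] using h1

theorem aux_integral_inner (φ : ℝ → Esp n) (hφ : Continuous φ) (b : Esp n) :
    ∫ t in (0:ℝ)..1, ⟪φ t, b⟫ = ⟪∫ t in (0:ℝ)..1, φ t, b⟫ := by
  have := (innerSL ℝ b).intervalIntegral_comp_comm (hφ.intervalIntegrable (μ := MeasureTheory.volume) 0 1)
  simp only [innerSL_apply_apply] at this
  rw [real_inner_comm, ← this]
  simp only [real_inner_comm]

/-- Space of trigonometric polynomials of degree at most `m`. -/
abbrev Gal (n m : ℕ) := PiLp 2 (fun _ : (Finset.Icc (-(m:ℤ)) m) => Esp n)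

def ev (m : ℕ) (t : ℝ) (a : Gal n m) : Esp n :=
  ∑ k : (Finset.Icc (-(m:ℤ)) m), eexp k t • a k

def evL (m : ℕ) (t : ℝ) : Gal n m →L[ℝ] Esp n :=
  LinearMap.toContinuousLinearMap
    { toFun := ev m t
      map_add' := fun a b => by simp [ev, Finset.sum_add_distrib]
      map_smul' := fun c a => by
        simp only [ev, RingHom.id_apply, Finset.smul_sum, PiLp.smul_apply]
        exact Finset.sum_congr rfl fun k _ => smul_comm _ _ _ }

theorem evL_apply (m : ℕ) (t : ℝ) (a : Gal n m) : evL m t a = ev m t a := rfl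

theorem ev_contDiff (m : ℕ) : ContDiff ℝ 1 (fun p : ℝ × Gal n m => ev m p.1 p.2) := by
  unfold ev
  refine ContDiff.sum fun k _ => ?_
  have h1 : ContDiff ℝ 1 fun p : ℝ × Gal n m => eexp k p.1 := (eexp_contDiff k).comp contDiff_fst
  have h2 : ContDiff ℝ 1 fun p : ℝ × Gal n m => p.2 k :=
    (PiLp.proj (𝕜 := ℝ) 2 (fun _ : (Finset.Icc (-(m:ℤ)) m) => Esp n) k).contDiff.comp contDiff_snd
  exact h1.smul h2

theorem ev_continuous (m : ℕ) (a : Gal n m) : Continuous (fun t => ev m t a) := by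
  unfold ev
  exact continuous_finsetSum _ fun k _ => (eexp_continuous k).smul continuous_const

theorem ev_periodic (m : ℕ) (a : Gal n m) (t : ℝ) : ev m (t + 1) a = ev m t a := by
  simp [ev, eexp_periodic]

theorem ev_pair (m : ℕ) (φ : ℝ → Esp n) (hφ : Continuous φ) (b : Gal n m) :
    ∫ t in (0:ℝ)..1, ⟪φ t, ev m t b⟫ =
      ∑ k : (Finset.Icc (-(m:ℤ)) m), ⟪∫ t in (0:ℝ)..1, eexp (-k) t • φ t, b k⟫ := by
  have hc : ∀ k : ℤ, Continuous fun t => eexp (-k) t • φ t := fun k =>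
    (eexp_continuous _).smul hφ
  simp only [← aux_integral_inner _ (hc _)]
  rw [← intervalIntegral.integral_finsetSum]
  · congr 1
    ext t
    simp only [ev, inner_sum]
    refine Finset.sum_congr rfl fun k _ => ?_
    rw [aux_inner_smul, eexp_conj, neg_neg]
  · intro k _
    exact ((hc k).inner continuous_const).intervalIntegrable _ _

theorem ev_coeff (m : ℕ) (a : Gal n m) (k : (Finset.Icc (-(m:ℤ)) m)) :
    ∫ t in (0:ℝ)..1, eexp (-k) t • ev m t a = a k := by
  have h : ∀ t, eexp (-k) t • ev m t a =
      ∑ l : (Finset.Icc (-(m:ℤ)) m), eexp (-k + l) t • a l := by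
    intro t
    simp only [ev, Finset.smul_sum, smul_smul, eexp_mul]
  simp only [h]
  rw [intervalIntegral.integral_finsetSum]
  · simp only [intervalIntegral.integral_smul_const, eexp_integral]
    rw [Finset.sum_eq_single k]
    · simp
    · intro l _ hl
      have : ¬ (-(k:ℤ) + l = 0) := fun h => hl (Subtype.ext (by omega))
      simp [this]
    · simp
  · intro l _
    exact ((eexp_continuous _).smul continuous_const).intervalIntegrable _ _

theorem ev_parseval (m : ℕ) (a b : Gal n m) :
    ∫ t in (0:ℝ)..1, ⟪ev m t a, ev m t b⟫ = ∑ k : (Finset.Icc (-(m:ℤ)) m), ⟪a k, b k⟫ := by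
  rw [ev_pair m _ (ev_continuous m a)]
  simp only [ev_coeff]

theorem ev_bessel (m : ℕ) (φ : ℝ → Esp n) (hφ : Continuous φ) (M : ℝ)
    (hM : ∀ t, ‖φ t‖ ≤ M) (b : Gal n m)
    (hb : ∀ k, b k = ∫ t in (0:ℝ)..1, eexp (-k) t • φ t) : ‖b‖ ≤ M := by
  have hM0 : 0 ≤ M := (norm_nonneg _).trans (hM 0)
  have h1 := ev_pair m φ hφ b
  have h2 := ev_parseval m b b
  simp only [← hb] at h1
  have h3 : ∑ k : (Finset.Icc (-(m:ℤ)) m), ⟪b k, b k⟫ = ‖b‖ ^ 2 := by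
    rw [← real_inner_self_eq_norm_sq, PiLp.inner_apply]
  rw [h3] at h1 h2
  have hc := ev_continuous m b
  have h4 : ∫ t in (0:ℝ)..1, ⟪φ t, ev m t b⟫ ≤
      ∫ t in (0:ℝ)..1, (M ^ 2 / 2 + ⟪ev m t b, ev m t b⟫ / 2) := by
    apply intervalIntegral.integral_mono_on zero_le_one
    · exact (hφ.inner hc).intervalIntegrable _ _
    · exact (continuous_const.add ((hc.inner hc).div_const _)).intervalIntegrable _ _
    · intro t _
      have h5 := real_inner_le_norm (φ t) (ev m t b)
      rw [real_inner_self_eq_norm_sq]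
      have h6 := hM t
      nlinarith [sq_nonneg (‖φ t‖ - ‖ev m t b‖), norm_nonneg (φ t)]
  rw [intervalIntegral.integral_add intervalIntegrable_const
    (((hc.inner hc).div_const _).intervalIntegrable _ _), intervalIntegral.integral_div,
    intervalIntegral.integral_div, h2, h1] at h4
  simp at h4
  nlinarith [norm_nonneg b]

theorem gal_norm_le_sum {ι : Type*} [Fintype ι] (b : PiLp 2 (fun _ : ι => Esp n)) :
    ‖b‖ ≤ ∑ k, ‖b k‖ := by
  rw [PiLp.norm_eq_of_L2]
  apply Real.sqrt_le_iff.2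
  refine ⟨by positivity, ?_⟩
  exact Finset.sum_sq_le_sq_sum_of_nonneg fun k _ => norm_nonneg _

/-- The Galerkin action functional. -/
def galF (H : ℝ → Esp n → ℝ) (m : ℕ) (a : Gal n m) : ℝ :=
  -Real.pi * ∑ k : (Finset.Icc (-(m:ℤ)) m), ((k:ℤ):ℝ) * ‖a k‖ ^ 2 +
    ∫ t in (0:ℝ)..1, H t (ev m t a)

/-- The gradient of the Galerkin action functional. -/
def galG (g : ℝ → Esp n → Esp n) (m : ℕ) (a : Gal n m) : Gal n m :=
  WithLp.toLp 2 (fun k : (Finset.Icc (-(m:ℤ)) m) => (-(2 * Real.pi * ((k:ℤ):ℝ))) • a k +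
    ∫ t in (0:ℝ)..1, eexp (-k) t • g t (ev m t a))

theorem galG_apply (g : ℝ → Esp n → Esp n) (m : ℕ) (a : Gal n m) (k : (Finset.Icc (-(m:ℤ)) m)) :
    galG g m a k = (-(2 * Real.pi * ((k:ℤ):ℝ))) • a k +
    ∫ t in (0:ℝ)..1, eexp (-k) t • g t (ev m t a) := rfl

theorem gal_cont (g : ℝ → Esp n → Esp n)
    (hg1 : ContDiff ℝ 1 (fun p : ℝ × Esp n => g p.1 p.2)) (m : ℕ) (a : Gal n m) :
    Continuous (fun t => g t (ev m t a)) :=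
  hg1.continuous.comp (continuous_id.prodMk (ev_continuous m a))

theorem galG_contDiff (g : ℝ → Esp n → Esp n)
    (hg1 : ContDiff ℝ 1 (fun p : ℝ × Esp n => g p.1 p.2)) (m : ℕ) :
    ContDiff ℝ 1 (galG g m) := by
  rw [contDiff_piLp]
  intro k
  simp only [galG_apply]
  refine ContDiff.add ?_ ?_
  · exact ((-(2 * Real.pi * ((k:ℤ):ℝ))) •
      (PiLp.proj (𝕜 := ℝ) 2 (fun _ : (Finset.Icc (-(m:ℤ)) m) => Esp n) k)).contDiff
  · refine (aux_param (fun t (a : Gal n m) => eexp (-k) t • g t (ev m t a)) ?_).2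
    have h1 : ContDiff ℝ 1 fun p : ℝ × Gal n m => eexp (-k) p.1 :=
      (eexp_contDiff _).comp contDiff_fst
    have h2 : ContDiff ℝ 1 fun p : ℝ × Gal n m => g p.1 (ev m p.1 p.2) :=
      hg1.comp (contDiff_fst.prodMk (ev_contDiff m))
    exact h1.smul h2

theorem galF_grad (H : ℝ → Esp n → ℝ) (g : ℝ → Esp n → Esp n)
    (hsm : ContDiff ℝ 1 (fun p : ℝ × Esp n => H p.1 p.2))
    (hg1 : ContDiff ℝ 1 (fun p : ℝ × Esp n => g p.1 p.2))
    (hgrad : ∀ t x, HasGradientAt (H t) (g t x) x) (m : ℕ) (a : Gal n m) :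
    HasGradientAt (galF H m) (galG g m a) a := by
  rw [hasGradientAt_iff_hasFDerivAt]
  have hc : Continuous (fun t => g t (ev m t a)) := gal_cont g hg1 m a
  have hu : ContDiff ℝ 1 (fun p : ℝ × Gal n m => H p.1 (ev m p.1 p.2)) :=
    hsm.comp (contDiff_fst.prodMk (ev_contDiff m))
  have h1 := (aux_param (fun t (a : Gal n m) => H t (ev m t a)) hu).1 a
  have hfd : ∀ t, fderiv ℝ (fun a : Gal n m => H t (ev m t a)) a =
      (InnerProductSpace.toDual ℝ (Esp n) (g t (ev m t a))).comp (evL m t) := by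
    intro t
    have h2 : HasFDerivAt (ev m t) (evL m t) a := (evL m t).hasFDerivAt
    exact ((hgrad t (ev m t a)).hasFDerivAt.comp a h2).fderiv
  have hq : ∀ k : (Finset.Icc (-(m:ℤ)) m), HasFDerivAt (fun a : Gal n m => ((k:ℤ):ℝ) * ‖a k‖ ^ 2)
      (((k:ℤ):ℝ) • (2 • (innerSL ℝ (a k)).comp
        (PiLp.proj (𝕜 := ℝ) 2 (fun _ : (Finset.Icc (-(m:ℤ)) m) => Esp n) k))) a := by
    intro k
    have h2 : HasFDerivAt (fun a : Gal n m => a k)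
      (PiLp.proj (𝕜 := ℝ) 2 (fun _ : (Finset.Icc (-(m:ℤ)) m) => Esp n) k) a :=
      (PiLp.proj (𝕜 := ℝ) 2 (fun _ : (Finset.Icc (-(m:ℤ)) m) => Esp n) k).hasFDerivAt
    exact h2.norm_sq.const_mul _
  have hQ := (HasFDerivAt.fun_sum (u := Finset.univ) fun k _ => hq k).const_mul (-Real.pi)
  have htot := hQ.add h1
  have hinteg : Continuous fun t => fderiv ℝ (fun a : Gal n m => H t (ev m t a)) a := by
    have h : ContDiff ℝ 1 (Function.uncurry fun (t : ℝ) (a : Gal n m) => H t (ev m t a)) := hu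
    exact (ContDiff.fderiv (m := 1) (n := 0) h contDiff_const (by simp)).continuous
  refine htot.congr_fderiv ?_
  ext b
  have e1 : (∫ t in (0:ℝ)..1, fderiv ℝ (fun a : Gal n m => H t (ev m t a)) a) b =
      ∫ t in (0:ℝ)..1, ⟪g t (ev m t a), ev m t b⟫ := by
    rw [ContinuousLinearMap.intervalIntegral_apply (hinteg.intervalIntegrable _ _)]
    simp only [hfd]
    rfl
  rw [add_apply, e1, ev_pair m _ hc]
  rw [InnerProductSpace.toDual_apply_apply, PiLp.inner_apply]
  simp only [galG_apply, inner_add_left, Finset.sum_add_distrib]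
  congr 1
  simp only [smul_apply, sum_apply, smul_eq_mul,
    Finset.mul_sum]
  refine Finset.sum_congr rfl fun k _ => ?_
  rw [real_inner_smul_left]
  simp
  ring

theorem ev_norm_le (m : ℕ) (t : ℝ) (a : Gal n m) :
    ‖ev m t a‖ ≤ ∑ k : (Finset.Icc (-(m:ℤ)) m), ‖a k‖ := by
  unfold ev
  refine (norm_sum_le _ _).trans (Finset.sum_le_sum fun k _ => ?_)
  rw [norm_smul, eexp_norm, one_mul]

theorem ev_norm_le' (m : ℕ) (t : ℝ) (a : Gal n m) :
    ‖ev m t a‖ ≤ (Fintype.card (Finset.Icc (-(m:ℤ)) m)) * ‖a‖ := by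
  refine (ev_norm_le m t a).trans ?_
  refine (Finset.sum_le_sum fun k _ => PiLp.norm_apply_le a k).trans ?_
  simp

theorem ev_sub (m : ℕ) (t : ℝ) (a b : Gal n m) : ev m t (a - b) = ev m t a - ev m t b := by
  rw [← evL_apply, map_sub, evL_apply, evL_apply]

theorem galG_lip (g : ℝ → Esp n → Esp n)
    (hg1 : ContDiff ℝ 1 (fun p : ℝ × Esp n => g p.1 p.2))
    (L : ℝ) (hL0 : 0 < L) (hL : ∀ t x y, ‖g t x - g t y‖ ≤ L * ‖x - y‖) (m : ℕ) :
    ∃ L', ∀ a b : Gal n m, ‖galG g m a - galG g m b‖ ≤ L' * ‖a - b‖ := by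
  let N : ℝ := Fintype.card (Finset.Icc (-(m:ℤ)) m)
  refine ⟨∑ k : (Finset.Icc (-(m:ℤ)) m), (2 * Real.pi * |((k:ℤ):ℝ)| + L * N), fun a b => ?_⟩
  refine (gal_norm_le_sum _).trans ?_
  rw [Finset.sum_mul]
  refine Finset.sum_le_sum fun k _ => ?_
  have hc : ∀ a : Gal n m, IntervalIntegrable (fun t => eexp (-k) t • g t (ev m t a))
      MeasureTheory.volume 0 1 := fun a =>
    ((eexp_continuous _).smul (gal_cont g hg1 m a)).intervalIntegrable _ _
  have e : (galG g m a - galG g m b) k = (-(2 * Real.pi * ((k:ℤ):ℝ))) • (a - b) k +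
      ∫ t in (0:ℝ)..1, (eexp (-k) t • g t (ev m t a) - eexp (-k) t • g t (ev m t b)) := by
    rw [intervalIntegral.integral_sub (hc a) (hc b), PiLp.sub_apply, PiLp.sub_apply, galG_apply,
      galG_apply, smul_sub]
    abel
  rw [e, add_mul]
  refine (norm_add_le _ _).trans (add_le_add ?_ ?_)
  · rw [norm_smul, norm_neg, Real.norm_eq_abs, abs_mul, abs_of_pos Real.two_pi_pos]
    gcongr
    exact PiLp.norm_apply_le _ k
  · have := intervalIntegral.norm_integral_le_of_norm_le_const (a := (0:ℝ)) (b := 1)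
      (C := L * N * ‖a - b‖)
      (f := fun t => eexp (-k) t • g t (ev m t a) - eexp (-k) t • g t (ev m t b)) (fun t _ => by
        rw [← smul_sub, norm_smul, eexp_norm, one_mul]
        refine (hL _ _ _).trans ?_
        rw [← ev_sub, mul_assoc]
        gcongr
        exact ev_norm_le' m t _)
    simpa using this

theorem galF_low (H : ℝ → Esp n → ℝ)
    (hcont : Continuous (fun p : ℝ × Esp n => H p.1 p.2)) (β : ℝ)
    (hβ : ∀ t x, β ≤ Real.pi * ‖x‖ ^ 2 + H t x) (m : ℕ) (a : Gal n m)
    (ha : ∀ k : (Finset.Icc (-(m:ℤ)) m), 0 ≤ (k:ℤ) → a k = 0) : β ≤ galF H m a := by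
  have hc := ev_continuous m a
  have hH : Continuous (fun t => H t (ev m t a)) := hcont.comp (continuous_id.prodMk hc)
  have h1 : Real.pi * ∫ t in (0:ℝ)..1, ‖ev m t a‖ ^ 2 ≤
      -Real.pi * ∑ k : (Finset.Icc (-(m:ℤ)) m), ((k:ℤ):ℝ) * ‖a k‖ ^ 2 := by
    have h2 : ∫ t in (0:ℝ)..1, ‖ev m t a‖ ^ 2 = ∑ k : (Finset.Icc (-(m:ℤ)) m), ‖a k‖ ^ 2 := by
      have := ev_parseval m a a
      simpa only [real_inner_self_eq_norm_sq] using this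
    rw [h2, neg_mul, ← mul_neg, ← Finset.sum_neg_distrib]
    refine mul_le_mul_of_nonneg_left (Finset.sum_le_sum fun k _ => ?_) Real.pi_pos.le
    by_cases hk : 0 ≤ (k:ℤ)
    · simp [ha k hk]
    · have hk' : ((k:ℤ):ℝ) ≤ -1 := by
        have : (k:ℤ) ≤ -1 := by omega
        exact_mod_cast this
      nlinarith [sq_nonneg ‖a k‖]
  have hc2 : Continuous fun t => Real.pi * ‖ev m t a‖ ^ 2 := by fun_prop
  have h3 : β ≤ ∫ t in (0:ℝ)..1, (Real.pi * ‖ev m t a‖ ^ 2 + H t (ev m t a)) := by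
    have := intervalIntegral.integral_mono_on (μ := MeasureTheory.volume) (a := (0:ℝ)) (b := 1)
      zero_le_one (f := fun _ => β)
      (g := fun t => Real.pi * ‖ev m t a‖ ^ 2 + H t (ev m t a))
      (by simp) ((hc2.add hH).intervalIntegrable _ _)
      (fun t _ => hβ t _)
    simpa using this
  rw [intervalIntegral.integral_add (hc2.intervalIntegrable _ _) (hH.intervalIntegrable _ _),
    intervalIntegral.integral_const_mul] at h3
  unfold galF
  linarith

theorem galF_int_le (H : ℝ → Esp n → ℝ)
    (hcont : Continuous (fun p : ℝ × Esp n => H p.1 p.2)) (C : ℝ)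
    (hC : ∀ t x, H t x ≤ C) (m : ℕ) (a : Gal n m) :
    ∫ t in (0:ℝ)..1, H t (ev m t a) ≤ C := by
  have hc := ev_continuous m a
  have hH : Continuous (fun t => H t (ev m t a)) := hcont.comp (continuous_id.prodMk hc)
  have := intervalIntegral.integral_mono_on (μ := MeasureTheory.volume) (a := (0:ℝ)) (b := 1)
      zero_le_one (g := fun _ => C)
      (f := fun t => H t (ev m t a)) (hH.intervalIntegrable _ _) (by simp)
      (fun t _ => hC t _)
  simpa using this

theorem gal_sum_nonneg (m : ℕ) (a : Gal n m)
    (ha : ∀ k : (Finset.Icc (-(m:ℤ)) m), (k:ℤ) < 0 → a k = 0) (k : (Finset.Icc (-(m:ℤ)) m)) :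
    0 ≤ ((k:ℤ):ℝ) * ‖a k‖ ^ 2 := by
  by_cases hk : (k:ℤ) < 0
  · simp [ha k hk]
  · have : (0:ℝ) ≤ ((k:ℤ):ℝ) := by exact_mod_cast not_lt.1 hk
    positivity

theorem galF_up (H : ℝ → Esp n → ℝ)
    (hcont : Continuous (fun p : ℝ × Esp n => H p.1 p.2)) (C : ℝ)
    (hC : ∀ t x, H t x ≤ C) (m : ℕ) (a : Gal n m)
    (ha : ∀ k : (Finset.Icc (-(m:ℤ)) m), (k:ℤ) < 0 → a k = 0) : galF H m a ≤ C := by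
  have h1 := galF_int_le H hcont C hC m a
  have h2 : 0 ≤ ∑ k : (Finset.Icc (-(m:ℤ)) m), ((k:ℤ):ℝ) * ‖a k‖ ^ 2 :=
    Finset.sum_nonneg fun k _ => gal_sum_nonneg m a ha k
  have := mul_nonneg Real.pi_pos.le h2
  unfold galF
  linarith

theorem galF_bd (R : ℝ) (H : ℝ → Esp n → ℝ)
    (hcont : Continuous (fun p : ℝ × Esp n => H p.1 p.2)) (C : ℝ) (hC0 : 0 < C)
    (hC : ∀ t x, H t x ≤ C) (hR : ∀ t x, R ≤ ‖x‖ → H t x = 0) (m : ℕ) :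
    ∃ ρ, ∀ a : Gal n m,
    (∀ k : (Finset.Icc (-(m:ℤ)) m), (k:ℤ) < 0 → a k = 0) → ρ ≤ ‖a‖ → galF H m a ≤ 0 := by
  classical
  obtain ⟨Mb, hMb0, hMb⟩ : ∃ Mb : ℝ, 0 ≤ Mb ∧ Real.pi * Mb ^ 2 = C := by
    refine ⟨Real.sqrt (C / Real.pi), Real.sqrt_nonneg _, ?_⟩
    have := Real.pi_pos
    rw [Real.sq_sqrt (by positivity)]
    field_simp
  let N : ℝ := Fintype.card (Finset.Icc (-(m:ℤ)) m)
  refine ⟨R + 2 * (N * Mb), fun a ha hρ => ?_⟩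
  have hsn := gal_sum_nonneg m a ha
  by_cases hex : ∃ k : (Finset.Icc (-(m:ℤ)) m), 1 ≤ (k:ℤ) ∧ Mb ≤ ‖a k‖
  · obtain ⟨k, hk, hak⟩ := hex
    have h1 := galF_int_le H hcont C hC m a
    have h2 : ((k:ℤ):ℝ) * ‖a k‖ ^ 2 ≤
        ∑ k : (Finset.Icc (-(m:ℤ)) m), ((k:ℤ):ℝ) * ‖a k‖ ^ 2 :=
      Finset.single_le_sum (fun k _ => hsn k) (Finset.mem_univ k)
    have h3 : Mb ^ 2 ≤ ((k:ℤ):ℝ) * ‖a k‖ ^ 2 := by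
      have h4 : (1:ℝ) ≤ ((k:ℤ):ℝ) := by exact_mod_cast hk
      have h5 : Mb ^ 2 ≤ ‖a k‖ ^ 2 := by gcongr
      nlinarith [sq_nonneg ‖a k‖]
    have := mul_le_mul_of_nonneg_left (h3.trans h2) Real.pi_pos.le
    unfold galF
    linarith
  · push Not at hex
    let z : (Finset.Icc (-(m:ℤ)) m) := ⟨0, by simp⟩
    have hsmall : ∀ k : (Finset.Icc (-(m:ℤ)) m), k ≠ z → ‖a k‖ ≤ Mb := by
      intro k hk
      have hk0 : (k:ℤ) ≠ 0 := fun h => hk (Subtype.ext h)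
      by_cases hk1 : (k:ℤ) < 0
      · simpa [ha k hk1] using hMb0
      · exact (hex k (by omega)).le
    have hrest : ∑ k ∈ Finset.univ.erase z, ‖a k‖ ≤ N * Mb := by
      refine (Finset.sum_le_card_nsmul _ _ Mb fun k hk => hsmall k (Finset.ne_of_mem_erase hk)).trans ?_
      rw [nsmul_eq_mul]
      refine mul_le_mul_of_nonneg_right ?_ hMb0
      exact Nat.cast_le.2 (Finset.card_le_univ _)
    have hz : R + N * Mb ≤ ‖a z‖ := by
      have := hρ.trans (gal_norm_le_sum a)
      rw [← Finset.add_sum_erase _ _ (Finset.mem_univ z)] at this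
      linarith
    have hev : ∀ t, R ≤ ‖ev m t a‖ := by
      intro t
      have e : ev m t a = a z + ∑ k ∈ Finset.univ.erase z, eexp k t • a k := by
        unfold ev
        rw [← Finset.add_sum_erase _ _ (Finset.mem_univ z)]
        simp [z, eexp_zero]
      have h1 : ‖∑ k ∈ Finset.univ.erase z, eexp k t • a k‖ ≤ N * Mb := by
        refine (norm_sum_le _ _).trans (le_trans (Finset.sum_le_sum fun k _ => ?_) hrest)
        rw [norm_smul, eexp_norm, one_mul]
      have h2 : ‖a z‖ ≤ ‖ev m t a‖ + ‖∑ k ∈ Finset.univ.erase z, eexp k t • a k‖ := by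
        have : a z = ev m t a - ∑ k ∈ Finset.univ.erase z, eexp k t • a k := by rw [e]; abel
        rw [this]
        exact norm_sub_le _ _
      linarith
    have h2 : 0 ≤ ∑ k : (Finset.Icc (-(m:ℤ)) m), ((k:ℤ):ℝ) * ‖a k‖ ^ 2 :=
      Finset.sum_nonneg fun k _ => hsn k
    have := mul_nonneg Real.pi_pos.le h2
    have h3 : ∀ t, H t (ev m t a) = 0 := fun t => hR t _ (hev t)
    unfold galF
    simp only [h3, intervalIntegral.integral_zero]
    linarith

/-- Extension by zero of nonnegative frequency coefficients. -/
def galExt (n m : ℕ) :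
    PiLp 2 (fun _ : {k : (Finset.Icc (-(m:ℤ)) m) // 0 ≤ (k:ℤ)} => Esp n) →L[ℝ] Gal n m :=
  LinearMap.toContinuousLinearMap
    { toFun := fun w => WithLp.toLp 2 (fun k => if h : 0 ≤ ((k:ℤ)) then w ⟨k, h⟩ else 0)
      map_add' := fun a b => by
        ext k i
        by_cases h : 0 ≤ ((k:ℤ)) <;> simp [h]
      map_smul' := fun c a => by
        ext k i
        by_cases h : 0 ≤ ((k:ℤ)) <;> simp [h] }

theorem galExt_apply (m : ℕ)
    (w : PiLp 2 (fun _ : {k : (Finset.Icc (-(m:ℤ)) m) // 0 ≤ (k:ℤ)} => Esp n))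
    (k : (Finset.Icc (-(m:ℤ)) m)) :
    galExt n m w k = if h : 0 ≤ ((k:ℤ)) then w ⟨k, h⟩ else 0 := rfl

/-- Restriction to nonnegative frequency coefficients. -/
def galRes (n m : ℕ) :
    Gal n m →L[ℝ] PiLp 2 (fun _ : {k : (Finset.Icc (-(m:ℤ)) m) // 0 ≤ (k:ℤ)} => Esp n) :=
  LinearMap.toContinuousLinearMap
    { toFun := fun a => WithLp.toLp 2 (fun k => a k.1)
      map_add' := fun _ _ => rfl
      map_smul' := fun _ _ => rfl }

theorem galRes_apply (m : ℕ) (a : Gal n m)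
    (k : {k : (Finset.Icc (-(m:ℤ)) m) // 0 ≤ (k:ℤ)}) : galRes n m a k = a k.1 := rfl

theorem gal_ps (R : ℝ) (H : ℝ → Esp n → ℝ) (g : ℝ → Esp n → Esp n)
    (hsm : ContDiff ℝ 1 (fun p : ℝ × Esp n => H p.1 p.2))
    (hg1 : ContDiff ℝ 1 (fun p : ℝ × Esp n => g p.1 p.2))
    (hgrad : ∀ t x, HasGradientAt (H t) (g t x) x)
    (L : ℝ) (hL0 : 0 < L) (hL : ∀ t x y, ‖g t x - g t y‖ ≤ L * ‖x - y‖)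
    (C : ℝ) (hC0 : 0 < C) (hC : ∀ t x, H t x ≤ C) (hR : ∀ t x, R ≤ ‖x‖ → H t x = 0)
    (β : ℝ) (hβ0 : 0 < β) (hβ : ∀ t x, β ≤ Real.pi * ‖x‖ ^ 2 + H t x)
    (m : ℕ) (ε : ℝ) (hε : 0 < ε) :
    ∃ a : Gal n m, β ≤ galF H m a ∧ ‖galG g m a‖ ≤ ε := by
  have hcont := hsm.continuous
  obtain ⟨L', hL'⟩ := galG_lip g hg1 L hL0 hL m
  obtain ⟨ρ, hρ⟩ := galF_bd R H hcont C hC0 hC hR m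
  have hP : ∀ w, galRes n m (galExt n m w) = w := by
    intro w
    ext k i
    rw [galRes_apply, galExt_apply, dif_pos k.2]
  have hneg : ∀ w, ∀ k : (Finset.Icc (-(m:ℤ)) m), (k:ℤ) < 0 → galExt n m w k = 0 := by
    intro w k hk
    rw [galExt_apply, dif_neg (not_le.2 hk)]
  obtain ⟨x, hx1, _, hx3⟩ := aux_saddle (galExt n m) (galRes n m) hP (galF H m) (galG g m)
    (galF_grad H g hsm hg1 hgrad m) (galG_contDiff g hg1 m) L' hL' β C
    ((‖galRes n m‖ + 1) * (|ρ| + 1)) hβ0 (by positivity)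
    (fun x hx => galF_low H hcont β hβ m x fun k hk => by
      have : galRes n m x ⟨k, hk⟩ = 0 := by rw [hx]; rfl
      exact this)
    (fun w hw => by
      refine (hρ _ (hneg w) ?_).trans (by positivity)
      have h1 : ‖w‖ ≤ (‖galRes n m‖ + 1) * ‖galExt n m w‖ := by
        have h2 := (galRes n m).le_opNorm (galExt n m w)
        rw [hP] at h2
        nlinarith [norm_nonneg (galExt n m w)]
      have h2 := le_of_mul_le_mul_left (hw.trans h1) (by positivity)
      have := le_abs_self ρ
      linarith)
    (fun w => galF_up H hcont C hC m _ (hneg w)) ε hε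
  exact ⟨x, hx1, hx3⟩

theorem ev_hasDerivAt (m : ℕ) (a c : Gal n m)
    (hc : ∀ k, c k = Complex.I • ((2 * Real.pi * ((k:ℤ):ℝ)) • a k)) (t : ℝ) :
    HasDerivAt (fun t => ev m t a) (ev m t c) t := by
  unfold ev
  refine HasDerivAt.fun_sum fun k _ => ?_
  have := (eexp_hasDerivAt k t).smul_const (a k)
  refine this.congr_deriv ?_
  rw [hc]
  ext i
  simp
  ring

theorem gal_norm_sq (m : ℕ) (a : Gal n m) : ∫ t in (0:ℝ)..1, ‖ev m t a‖ ^ 2 = ‖a‖ ^ 2 := by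
  have := ev_parseval m a a
  simp only [real_inner_self_eq_norm_sq] at this
  rw [this, PiLp.norm_sq_eq_of_L2]

theorem ev_holder_aux (m : ℕ) (a c : Gal n m) (D : ℝ) (hD : 0 < D)
    (hc : ∀ k, c k = Complex.I • ((2 * Real.pi * ((k:ℤ):ℝ)) • a k)) (hcD : ‖c‖ ≤ D)
    (s t : ℝ) (hs : 0 ≤ s) (hst : s < t) (ht : t ≤ 1) :
    ‖ev m t a - ev m s a‖ ≤ D * Real.sqrt (t - s) := by
  have hcc := ev_continuous m c
  set q := Real.sqrt (t - s) with hq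
  have hq0 : 0 < q := Real.sqrt_pos.2 (by linarith)
  have hq2 : q ^ 2 = t - s := Real.sq_sqrt (by linarith)
  have e1 : ∫ r in s..t, ev m r c = ev m t a - ev m s a :=
    intervalIntegral.integral_eq_sub_of_hasDerivAt (fun r _ => ev_hasDerivAt m a c hc r)
      (hcc.intervalIntegrable _ _)
  rw [← e1]
  have hc2 : Continuous fun r => ‖ev m r c‖ ^ 2 := by fun_prop
  have hc1 : Continuous fun r => ‖ev m r c‖ := by fun_prop
  have h1 : ∫ r in s..t, ‖ev m r c‖ ≤
      ∫ r in s..t, (D / q / 2 + (q / (2 * D)) * ‖ev m r c‖ ^ 2) := by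
    apply intervalIntegral.integral_mono_on hst.le (hc1.intervalIntegrable _ _)
      ((continuous_const.add (hc2.const_mul _)).intervalIntegrable _ _)
    intro r _
    show ‖ev m r c‖ ≤ D / q / 2 + (q / (2 * D)) * ‖ev m r c‖ ^ 2
    have : D / q / 2 + (q / (2 * D)) * ‖ev m r c‖ ^ 2 - ‖ev m r c‖ =
        (D - q * ‖ev m r c‖) ^ 2 / (2 * D * q) := by
      field_simp
      ring
    have h0 : 0 ≤ (D - q * ‖ev m r c‖) ^ 2 / (2 * D * q) := by positivity
    linarith
  have h2 : ∫ r in s..t, ‖ev m r c‖ ^ 2 ≤ D ^ 2 := by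
    have h3 : ∫ r in s..t, ‖ev m r c‖ ^ 2 ≤ ∫ r in (0:ℝ)..1, ‖ev m r c‖ ^ 2 := by
      apply intervalIntegral.integral_mono_interval hs hst.le ht
      · exact Filter.Eventually.of_forall fun r => by positivity
      · exact hc2.intervalIntegrable _ _
    rw [gal_norm_sq] at h3
    have : ‖c‖ ^ 2 ≤ D ^ 2 := by gcongr
    linarith
  rw [intervalIntegral.integral_add (by simp) ((hc2.const_mul _).intervalIntegrable _ _),
    intervalIntegral.integral_const_mul, intervalIntegral.integral_const, ← hq2] at h1
  have h4 : q / (2 * D) * ∫ r in s..t, ‖ev m r c‖ ^ 2 ≤ q / (2 * D) * D ^ 2 := by gcongr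
  have h5 : q ^ 2 • (D / q / 2) + q / (2 * D) * D ^ 2 = D * q := by
    rw [smul_eq_mul]; field_simp; norm_num
  have h6 := intervalIntegral.norm_integral_le_integral_norm (μ := MeasureTheory.volume)
    (f := fun r => ev m r c) hst.le
  linarith

theorem ev_holder (m : ℕ) (a c : Gal n m) (D : ℝ) (hD : 0 < D)
    (hc : ∀ k, c k = Complex.I • ((2 * Real.pi * ((k:ℤ):ℝ)) • a k)) (hcD : ‖c‖ ≤ D)
    (s t : ℝ) (hs : s ∈ Icc (0:ℝ) 1) (ht : t ∈ Icc (0:ℝ) 1) :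
    ‖ev m t a - ev m s a‖ ≤ D * Real.sqrt |t - s| := by
  rcases lt_trichotomy s t with h | h | h
  · rw [abs_of_pos (by linarith)]
    exact ev_holder_aux m a c D hD hc hcD s t hs.1 h ht.2
  · subst h; simp
  · rw [norm_sub_rev, abs_sub_comm, abs_of_pos (by linarith)]
    exact ev_holder_aux m a c D hD hc hcD t s ht.1 h hs.2

theorem gal_est (R : ℝ) (hR0 : 0 < R) (H : ℝ → Esp n → ℝ) (g : ℝ → Esp n → Esp n)
    (hg1 : ContDiff ℝ 1 (fun p : ℝ × Esp n => g p.1 p.2))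
    (hR : ∀ t x, R ≤ ‖x‖ → H t x = 0 ∧ g t x = 0)
    (M : ℝ) (hM0 : 0 < M) (hM : ∀ t x, ‖g t x‖ ≤ M)
    (β ε : ℝ) (hε0 : 0 < ε) (hε1 : ε ≤ 1) (hε2 : ε ^ 2 < 2 * β)
    (m : ℕ) (a : Gal n m) (hF : β ≤ galF H m a) (hG : ‖galG g m a‖ ≤ ε) :
    (∀ s ∈ Icc (0:ℝ) 1, ∀ t ∈ Icc (0:ℝ) 1,
      ‖ev m t a - ev m s a‖ ≤ (M + 1) * Real.sqrt |t - s|) ∧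
    (∀ t ∈ Icc (0:ℝ) 1, ‖ev m t a‖ ≤ R + M + 1) ∧
    (∀ k : ℤ, |k| ≤ m → ‖(-(2 * Real.pi * (k:ℝ))) • (∫ t in (0:ℝ)..1, eexp (-k) t • ev m t a) +
      ∫ t in (0:ℝ)..1, eexp (-k) t • g t (ev m t a)‖ ≤ ε) ∧
    β - ε * (R + M + 1) ≤ -(1 / 2) * (∫ t in (0:ℝ)..1, ⟪g t (ev m t a), ev m t a⟫) +
      ∫ t in (0:ℝ)..1, H t (ev m t a) := by
  set r := galG g m a with hr
  let d : Gal n m := WithLp.toLp 2 (fun k => (2 * Real.pi * ((k:ℤ):ℝ)) • a k)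
  let b : Gal n m := WithLp.toLp 2 (fun k => ∫ t in (0:ℝ)..1, eexp (-k) t • g t (ev m t a))
  let c : Gal n m := WithLp.toLp 2 (fun k => Complex.I • d k)
  have hgc := gal_cont g hg1 m a
  have hd : ∀ k, d k = (2 * Real.pi * ((k:ℤ):ℝ)) • a k := fun k => rfl
  have hck : ∀ k, c k = Complex.I • ((2 * Real.pi * ((k:ℤ):ℝ)) • a k) := fun k => rfl
  have hb : ‖b‖ ≤ M := ev_bessel m _ hgc M (fun t => hM _ _) b fun k => rfl
  have hrk : ∀ k, r k = - d k + b k := by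
    intro k
    rw [hr, galG_apply, hd, neg_smul]
  have hdbr : d = b - r := by
    ext k i
    rw [PiLp.sub_apply, hrk]
    simp
  have hdn : ‖d‖ ≤ M + 1 := by
    rw [hdbr]
    exact (norm_sub_le _ _).trans (by linarith)
  have hcn : ‖c‖ ≤ M + 1 := by
    have : ‖c‖ = ‖d‖ := by
      rw [PiLp.norm_eq_of_L2, PiLp.norm_eq_of_L2]
      congr 1
      refine Finset.sum_congr rfl fun k _ => ?_
      have : c k = Complex.I • d k := rfl
      rw [this, norm_smul]
      simp
    rwa [this]
  have hhol := ev_holder m a c (M + 1) (by linarith) hck hcn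
  -- the quadratic part
  have hQ : -Real.pi * ∑ k : (Finset.Icc (-(m:ℤ)) m), ((k:ℤ):ℝ) * ‖a k‖ ^ 2 =
      -(1 / 2) * ∑ k : (Finset.Icc (-(m:ℤ)) m), ⟪d k, a k⟫ := by
    rw [Finset.mul_sum, Finset.mul_sum]
    refine Finset.sum_congr rfl fun k _ => ?_
    rw [hd, real_inner_smul_left, real_inner_self_eq_norm_sq]
    ring
  have hbound : ∀ t ∈ Icc (0:ℝ) 1, ‖ev m t a‖ ≤ R + M + 1 := by
    by_contra! hcon
    obtain ⟨t0, ht0, hlt⟩ := hcon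
    have hfar : ∀ t ∈ Icc (0:ℝ) 1, R ≤ ‖ev m t a‖ := by
      intro t ht
      have h1 := hhol t t0 ht ht0
      have h2 : Real.sqrt |t0 - t| ≤ 1 := by
        rw [Real.sqrt_le_one, abs_le]
        constructor <;> linarith [ht.1, ht.2, ht0.1, ht0.2]
      have h3 : (M + 1) * Real.sqrt |t0 - t| ≤ (M + 1) * 1 := by gcongr
      have h4 : ‖ev m t0 a‖ ≤ ‖ev m t0 a - ev m t a‖ + ‖ev m t a‖ := by
        simpa using norm_add_le (ev m t0 a - ev m t a) (ev m t a)
      linarith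
    have hb0 : ∀ k, b k = 0 := by
      intro k
      have : b k = ∫ t in (0:ℝ)..1, eexp (-k) t • g t (ev m t a) := rfl
      rw [this, intervalIntegral.integral_congr (g := fun _ => (0 : Esp n))]
      · simp
      · intro t ht
        rw [uIcc_of_le zero_le_one] at ht
        simp [(hR t _ (hfar t ht)).2]
    have hH0 : ∫ t in (0:ℝ)..1, H t (ev m t a) = 0 := by
      rw [intervalIntegral.integral_congr (g := fun _ => (0 : ℝ))]
      · simp
      · intro t ht
        rw [uIcc_of_le zero_le_one] at ht
        simp [(hR t _ (hfar t ht)).1]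
    have hle : -(∑ k : (Finset.Icc (-(m:ℤ)) m), ⟪d k, a k⟫) ≤ ε ^ 2 := by
      have h1 : ∑ k : (Finset.Icc (-(m:ℤ)) m), ‖r k‖ ^ 2 ≤ ε ^ 2 := by
        rw [← PiLp.norm_sq_eq_of_L2]
        gcongr
      refine le_trans ?_ h1
      rw [← Finset.sum_neg_distrib]
      refine Finset.sum_le_sum fun k _ => ?_
      rw [hrk, hb0, add_zero, norm_neg, hd, real_inner_smul_left, real_inner_self_eq_norm_sq,
        norm_smul, mul_pow, Real.norm_eq_abs, sq_abs, ← neg_mul]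
      refine mul_le_mul_of_nonneg_right ?_ (by positivity)
      have h2 : -((k:ℤ):ℝ) ≤ ((k:ℤ):ℝ) ^ 2 := by
        have : -(k:ℤ) ≤ (k:ℤ) ^ 2 := by
          have := Int.le_self_sq (-(k:ℤ))
          simpa using this
        exact_mod_cast this
      have h3 := Real.pi_gt_three
      nlinarith [mul_le_mul_of_nonneg_left h2 Real.two_pi_pos.le, sq_nonneg ((k:ℤ):ℝ),
        mul_nonneg (sq_nonneg ((k:ℤ):ℝ)) (by nlinarith : (0:ℝ) ≤ (2 * Real.pi) ^ 2 - 2 * Real.pi)]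
    have : galF H m a = -(1 / 2) * ∑ k : (Finset.Icc (-(m:ℤ)) m), ⟪d k, a k⟫ := by
      unfold galF
      rw [hQ, hH0, add_zero]
    linarith
  refine ⟨fun s hs t ht => hhol s t hs ht, hbound, ?_, ?_⟩
  · intro k hk
    let k' : (Finset.Icc (-(m:ℤ)) m) := ⟨k, by rw [Finset.mem_Icc]; exact abs_le.1 hk⟩
    have h1 := ev_coeff m a k'
    have h2 : (k' : ℤ) = k := rfl
    rw [h2] at h1
    rw [h1]
    exact (PiLp.norm_apply_le r k').trans hG
  · have hp := ev_pair m _ hgc a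
    rw [hp]
    have hsum : ∑ k : (Finset.Icc (-(m:ℤ)) m), ⟪d k, a k⟫ =
        ∑ k : (Finset.Icc (-(m:ℤ)) m), ⟪∫ t in (0:ℝ)..1, eexp (-k) t • g t (ev m t a), a k⟫ -
          ⟪r, a⟫ := by
      rw [PiLp.inner_apply, ← Finset.sum_sub_distrib]
      refine Finset.sum_congr rfl fun k _ => ?_
      rw [← inner_sub_left, hrk]
      congr 1
      have : b k = ∫ t in (0:ℝ)..1, eexp (-k) t • g t (ev m t a) := rfl
      rw [this]; abel
    have ha : ‖a‖ ≤ R + M + 1 := by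
      have h1 : ‖a‖ ^ 2 ≤ (R + M + 1) ^ 2 := by
        rw [← gal_norm_sq]
        have hc2 : Continuous fun t => ‖ev m t a‖ ^ 2 := by
          have := ev_continuous m a
          fun_prop
        have := intervalIntegral.integral_mono_on (μ := MeasureTheory.volume) (a := (0:ℝ)) (b := 1)
          zero_le_one (g := fun _ => (R + M + 1) ^ 2)
          (f := fun t => ‖ev m t a‖ ^ 2) (hc2.intervalIntegrable _ _) (by simp)
          (fun t ht => by
            have := hbound t ht
            gcongr)
        simpa using this
      exact le_of_sq_le_sq h1 (by positivity)
    have hra : ⟪r, a⟫ ≤ ε * (R + M + 1) := by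
      refine (real_inner_le_norm _ _).trans ?_
      gcongr
    have hpos : 0 ≤ ε * (R + M + 1) := by positivity
    unfold galF at hF
    rw [hQ, hsum] at hF
    linarith

theorem lim_exists (y : ℕ → ℝ → Esp n) (hc : ∀ j, Continuous (y j))
    (hp : ∀ j t, y j (t + 1) = y j t) (D B : ℝ)
    (hD : ∀ j, ∀ s ∈ Icc (0:ℝ) 1, ∀ t ∈ Icc (0:ℝ) 1, ‖y j t - y j s‖ ≤ D * Real.sqrt |t - s|)
    (hB : ∀ j, ∀ t ∈ Icc (0:ℝ) 1, ‖y j t‖ ≤ B) :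
    ∃ (φ : ℕ → ℕ) (Y : ℝ → Esp n), StrictMono φ ∧ Continuous Y ∧ (∀ t, Y (t + 1) = Y t) ∧
      ∀ t, Filter.Tendsto (fun j => y (φ j) t) Filter.atTop (𝓝 (Y t)) := by
  let F : ℕ → BoundedContinuousFunction (Icc (0:ℝ) 1) (Esp n) := fun j =>
    BoundedContinuousFunction.mkOfCompact ⟨fun t => y j t, (hc j).comp continuous_subtype_val⟩
  have hF : ∀ j t, F j t = y j t := fun j t => rfl
  have hK : IsCompact (closure (range F)) := by
    apply BoundedContinuousFunction.arzela_ascoli (closedBall (0 : Esp n) B)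
      (isCompact_closedBall _ _)
    · rintro f x ⟨j, rfl⟩
      rw [mem_closedBall_zero_iff, hF]
      exact hB j x x.2
    · refine Metric.equicontinuous_of_continuity_modulus (fun x => D * Real.sqrt x) ?_ _ ?_
      · have : Continuous fun x => D * Real.sqrt x := by fun_prop
        simpa using this.tendsto 0
      · rintro x z ⟨f, j, rfl⟩
        show dist (F j x) (F j z) ≤ _
        rw [hF, hF, dist_eq_norm, Subtype.dist_eq, Real.dist_eq]
        exact hD j z z.2 x x.2
  obtain ⟨f, _, φ, hφ, hlim⟩ := hK.tendsto_subseq (x := F) fun j => subset_closure ⟨j, rfl⟩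
  have hfr : ∀ t : ℝ, Int.fract t ∈ Icc (0:ℝ) 1 := fun t =>
    ⟨Int.fract_nonneg t, (Int.fract_lt_one t).le⟩
  have hyf : ∀ j t, y j t = F j ⟨Int.fract t, hfr t⟩ := by
    intro j t
    rw [hF]
    have : Function.Periodic (y j) 1 := hp j
    have h1 := this.sub_int_mul_eq (x := t) ⌊t⌋
    rw [mul_one] at h1
    exact h1.symm
  let Y : ℝ → Esp n := fun t => f ⟨Int.fract t, hfr t⟩
  have hU : TendstoUniformly (fun j => y (φ j)) Y Filter.atTop := by
    have := BoundedContinuousFunction.tendsto_iff_tendstoUniformly.1 hlim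
    have h2 := this.comp (fun t : ℝ => (⟨Int.fract t, hfr t⟩ : Icc (0:ℝ) 1))
    have h3 : (fun j => y (φ j)) =
        fun j => ⇑((F ∘ φ) j) ∘ fun t : ℝ => (⟨Int.fract t, hfr t⟩ : Icc (0:ℝ) 1) := by
      funext j t
      exact hyf (φ j) t
    rw [h3]
    exact h2
  refine ⟨φ, Y, hφ, hU.continuous (Filter.Eventually.of_forall fun j => hc _).frequently, ?_,
    fun t => hU.tendsto_at t⟩
  intro t
  simp [Y]

theorem lim_integral {F : Type*} [NormedAddCommGroup F] [NormedSpace ℝ F]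
    (u : ℕ → ℝ → F) (v : ℝ → F) (hc : ∀ j, Continuous (u j)) (B : ℝ)
    (hB : ∀ j, ∀ t ∈ Icc (0:ℝ) 1, ‖u j t‖ ≤ B)
    (hl : ∀ t, Filter.Tendsto (fun j => u j t) Filter.atTop (𝓝 (v t))) :
    Filter.Tendsto (fun j => ∫ t in (0:ℝ)..1, u j t) Filter.atTop (𝓝 (∫ t in (0:ℝ)..1, v t)) := by
  apply intervalIntegral.tendsto_integral_filter_of_dominated_convergence (fun _ => B)
  · exact Filter.Eventually.of_forall fun j => (hc j).aestronglyMeasurable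
  · refine Filter.Eventually.of_forall fun j => Filter.Eventually.of_forall fun t ht => hB j t ?_
    rw [uIoc_of_le zero_le_one] at ht
    exact Ioc_subset_Icc_self ht
  · simp
  · exact Filter.Eventually.of_forall fun t _ => hl t

theorem weak_orbit (R : ℝ) (hR0 : 0 < R) (H : ℝ → Esp n → ℝ) (g : ℝ → Esp n → Esp n)
    (hsm : ContDiff ℝ 1 (fun p : ℝ × Esp n => H p.1 p.2))
    (hnonneg : ∀ t x, 0 ≤ H t x)
    (hg1 : ContDiff ℝ 1 (fun p : ℝ × Esp n => g p.1 p.2))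
    (hgrad : ∀ t x, HasGradientAt (H t) (g t x) x)
    (hR : ∀ t x, R ≤ ‖x‖ → H t x = 0 ∧ g t x = 0)
    (M : ℝ) (hM0 : 0 < M) (hM : ∀ t x, ‖g t x‖ ≤ M)
    (L : ℝ) (hL0 : 0 < L) (hL : ∀ t x y, ‖g t x - g t y‖ ≤ L * ‖x - y‖)
    (C : ℝ) (hC0 : 0 < C) (hC : ∀ t x, H t x ≤ C)
    (β : ℝ) (hβ0 : 0 < β) (hβ : ∀ t x, β ≤ Real.pi * ‖x‖ ^ 2 + H t x) :
    ∃ Y : ℝ → Esp n, Continuous Y ∧ (∀ t, Y (t + 1) = Y t) ∧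
      (∀ k : ℤ, (-(2 * Real.pi * (k:ℝ))) • (∫ t in (0:ℝ)..1, eexp (-k) t • Y t) +
        ∫ t in (0:ℝ)..1, eexp (-k) t • g t (Y t) = 0) ∧
      β ≤ -(1 / 2) * (∫ t in (0:ℝ)..1, ⟪g t (Y t), Y t⟫) + ∫ t in (0:ℝ)..1, H t (Y t) := by
  let η : ℝ := min 1 β
  have hη0 : 0 < η := lt_min one_pos hβ0
  let ε : ℕ → ℝ := fun m => η / ((m:ℝ) + 1)
  have hε0 : ∀ m, 0 < ε m := fun m => by positivity
  have hεη : ∀ m, ε m ≤ η := fun m => by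
    apply div_le_self hη0.le
    have : (0:ℝ) ≤ m := by positivity
    linarith
  have hε1 : ∀ m, ε m ≤ 1 := fun m => (hεη m).trans (min_le_left _ _)
  have hεβ : ∀ m, ε m ≤ β := fun m => (hεη m).trans (min_le_right _ _)
  have hε2 : ∀ m, ε m ^ 2 < 2 * β := fun m => by
    nlinarith [hε0 m, hε1 m, hεβ m]
  have hεl : Filter.Tendsto ε Filter.atTop (𝓝 0) := by
    have := (tendsto_one_div_add_atTop_nhds_zero_nat (𝕜 := ℝ)).const_mul η
    simpa [ε, div_eq_mul_inv] using this
  choose a ha1 ha2 using fun m => gal_ps R H g hsm hg1 hgrad L hL0 hL C hC0 hC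
    (fun t x hx => (hR t x hx).1) β hβ0 hβ m (ε m) (hε0 m)
  have est := fun m => gal_est R hR0 H g hg1 hR M hM0 hM β (ε m) (hε0 m) (hε1 m) (hε2 m) m (a m)
    (ha1 m) (ha2 m)
  obtain ⟨φ, Y, hφ, hYc, hYp, hlim⟩ := lim_exists (fun m t => ev m t (a m))
    (fun m => ev_continuous m _) (fun m => ev_periodic m _) (M + 1) (R + M + 1)
    (fun m => (est m).1) (fun m => (est m).2.1)
  have hφl := hφ.tendsto_atTop
  have hgl : ∀ t, Filter.Tendsto (fun j => g t (ev (φ j) t (a (φ j)))) Filter.atTop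
      (𝓝 (g t (Y t))) := by
    intro t
    have : Continuous fun x => g t x := hg1.continuous.comp (Continuous.prodMk_right t)
    exact (this.tendsto _).comp (hlim t)
  have hHl : ∀ t, Filter.Tendsto (fun j => H t (ev (φ j) t (a (φ j)))) Filter.atTop
      (𝓝 (H t (Y t))) := by
    intro t
    have : Continuous fun x => H t x := hsm.continuous.comp (Continuous.prodMk_right t)
    exact (this.tendsto _).comp (hlim t)
  have hgc := fun m => gal_cont g hg1 m (a m)
  refine ⟨Y, hYc, hYp, ?_, ?_⟩
  · intro k
    have l1 := lim_integral (fun j t => eexp (-k) t • ev (φ j) t (a (φ j)))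
      (fun t => eexp (-k) t • Y t) (fun j => (eexp_continuous _).smul (ev_continuous _ _))
      (R + M + 1) (fun j t ht => by
        rw [norm_smul, eexp_norm, one_mul]; exact (est (φ j)).2.1 t ht)
      (fun t => (hlim t).const_smul _)
    have l2 := lim_integral (fun j t => eexp (-k) t • g t (ev (φ j) t (a (φ j))))
      (fun t => eexp (-k) t • g t (Y t)) (fun j => (eexp_continuous _).smul (hgc _))
      M (fun j t ht => by
        rw [norm_smul, eexp_norm, one_mul]; exact hM _ _)
      (fun t => (hgl t).const_smul _)
    have l3 := ((l1.const_smul (-(2 * Real.pi * (k:ℝ)))).add l2).norm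
    have l4 := le_of_tendsto_of_tendsto l3 (hεl.comp hφl) (by
      filter_upwards [Filter.eventually_ge_atTop k.natAbs] with j hj
      refine (est (φ j)).2.2.1 k ?_
      have := hφ.id_le j
      simp only [id] at this
      rw [Int.abs_eq_natAbs]
      omega)
    exact norm_le_zero_iff.1 l4
  · have l1 := lim_integral (fun j t => ⟪g t (ev (φ j) t (a (φ j))), ev (φ j) t (a (φ j))⟫)
      (fun t => ⟪g t (Y t), Y t⟫) (fun j => (hgc _).inner (ev_continuous _ _))
      (M * (R + M + 1)) (fun j t ht => by
        refine (norm_inner_le_norm _ _).trans ?_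
        exact mul_le_mul (hM _ _) ((est (φ j)).2.1 t ht) (norm_nonneg _) hM0.le)
      (fun t => (hgl t).inner (hlim t))
    have l2 := lim_integral (fun j t => H t (ev (φ j) t (a (φ j))))
      (fun t => H t (Y t))
      (fun j => hsm.continuous.comp (continuous_id.prodMk (ev_continuous (φ j) (a (φ j)))))
      C (fun j t ht => by
        rw [Real.norm_eq_abs, abs_of_nonneg (hnonneg _ _)]; exact hC _ _)
      hHl
    have l3 := (l1.const_mul (-(1 / 2))).add l2
    have l4 : Filter.Tendsto (fun j => β - ε (φ j) * (R + M + 1)) Filter.atTop (𝓝 β) := by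
      have := ((hεl.comp hφl).mul_const (R + M + 1)).const_sub β
      simpa using this
    exact le_of_tendsto_of_tendsto l4 l3 (Filter.Eventually.of_forall fun j => (est (φ j)).2.2.2)

theorem fourier_const (u : ℝ → ℂ) (hc : Continuous u) (hp : ∀ t, u (t + 1) = u t)
    (h0 : ∀ k : ℤ, k ≠ 0 → ∫ t in (0:ℝ)..1, eexp (-k) t * u t = 0) (t : ℝ) : u t = u 0 := by
  have : Fact ((0:ℝ) < 1) := ⟨one_pos⟩
  have hp' : Function.Periodic u 1 := hp
  have hlc : Continuous (hp'.lift : AddCircle (1:ℝ) → ℂ) := by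
    unfold Function.Periodic.lift
    exact hc.quotient_liftOn' _
  let U : C(AddCircle (1:ℝ), ℂ) := ⟨hp'.lift, hlc⟩
  have hU : ∀ t : ℝ, U (t : AddCircle (1:ℝ)) = u t := fun t => hp'.lift_coe t
  have hco : ∀ k : ℤ, k ≠ 0 → fourierCoeff U k = 0 := by
    intro k hk
    rw [fourierCoeff_eq_intervalIntegral U k 0]
    have : ∀ x : ℝ, fourier (-k) (x : AddCircle (1:ℝ)) • U (x : AddCircle (1:ℝ)) =
        eexp (-k) x * u x := by
      intro x
      rw [hU, fourier_coe_apply, smul_eq_mul]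
      congr 1
      unfold eexp
      congr 1
      push_cast
      ring
    simp only [this, zero_add, h0 k hk, smul_zero]
  have hsum : Summable (fourierCoeff U) := by
    apply summable_of_ne_finset_zero (s := {0})
    intro k hk
    exact hco k (by simpa using hk)
  have h1 := hasSum_fourier_series_of_summable hsum
  have h2 : HasSum (fun i => fourierCoeff U i • (fourier i : C(AddCircle (1:ℝ), ℂ)))
      (fourierCoeff U 0 • (fourier 0 : C(AddCircle (1:ℝ), ℂ))) := by
    apply hasSum_single
    intro k hk
    rw [hco k hk, zero_smul]
  have h3 := h1.unique h2
  have h4 : ∀ t : ℝ, u t = fourierCoeff U 0 := by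
    intro t
    rw [← hU]
    have h5 := DFunLike.congr_fun h3 (t : AddCircle (1:ℝ))
    rw [h5]
    simp
  rw [h4 t, h4 0]

theorem strong_orbit (g : ℝ → Esp n → Esp n)
    (hgc : Continuous (fun p : ℝ × Esp n => g p.1 p.2))
    (hgp : ∀ t x, g (t + 1) x = g t x)
    (Y : ℝ → Esp n) (hYc : Continuous Y) (hYp : ∀ t, Y (t + 1) = Y t)
    (hY : ∀ k : ℤ, (-(2 * Real.pi * (k:ℝ))) • (∫ t in (0:ℝ)..1, eexp (-k) t • Y t) +
        ∫ t in (0:ℝ)..1, eexp (-k) t • g t (Y t) = 0) (t : ℝ) :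
    HasDerivAt Y (Complex.I • g t (Y t)) t := by
  let w : ℝ → Esp n := fun s => Complex.I • g s (Y s)
  have hgYc : Continuous fun s => g s (Y s) := hgc.comp (continuous_id.prodMk hYc)
  have hwc : Continuous w := hgYc.const_smul Complex.I
  have hwp : Function.Periodic w 1 := fun s => by simp only [w, hYp, hgp]
  let U : ℝ → Esp n := fun t => ∫ s in (0:ℝ)..t, w s
  have hUd : ∀ t, HasDerivAt U (w t) t := fun t =>
    intervalIntegral.integral_hasDerivAt_right (hwc.intervalIntegrable _ _)
      (hwc.stronglyMeasurableAtFilter _ _) hwc.continuousAt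
  have hUc : Continuous U := continuous_iff_continuousAt.2 fun t => (hUd t).continuousAt
  have hU0 : U 0 = 0 := by simp [U]
  have hU1 : U 1 = 0 := by
    have := hY 0
    simp only [neg_zero, eexp_zero, one_smul, Int.cast_zero, mul_zero, zero_smul, zero_add] at this
    show ∫ s in (0:ℝ)..1, Complex.I • g s (Y s) = 0
    rw [intervalIntegral.integral_smul, this, smul_zero]
  have hUp : ∀ t, U (t + 1) = U t := by
    intro t
    have h1 : U t + ∫ s in t..(t + 1), w s = U (t + 1) :=
      intervalIntegral.integral_add_adjacent_intervals (hwc.intervalIntegrable _ _)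
        (hwc.intervalIntegrable _ _)
    have h2 := hwp.intervalIntegral_add_eq t 0
    rw [zero_add] at h2
    have h3 : ∫ s in (0:ℝ)..1, w s = 0 := hU1
    rw [← h1, h2, h3, add_zero]
  have hcoef : ∀ k : ℤ, k ≠ 0 → ∫ t in (0:ℝ)..1, eexp (-k) t • (Y t - U t) = 0 := by
    intro k hk
    have hec := eexp_continuous (-k)
    have hYi : IntervalIntegrable (fun t => eexp (-k) t • Y t) MeasureTheory.volume 0 1 :=
      (hec.smul hYc).intervalIntegrable _ _
    have hUi : IntervalIntegrable (fun t => eexp (-k) t • U t) MeasureTheory.volume 0 1 :=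
      (hec.smul hUc).intervalIntegrable _ _
    have hUi2 : IntervalIntegrable (fun t => (-(2 * Real.pi * (k:ℝ))) • (eexp (-k) t • U t))
        MeasureTheory.volume 0 1 :=
      ((hec.smul hUc).const_smul (-(2 * Real.pi * (k:ℝ)))).intervalIntegrable _ _
    have hgi : IntervalIntegrable (fun t => eexp (-k) t • g t (Y t)) MeasureTheory.volume 0 1 :=
      (hec.smul hgYc).intervalIntegrable _ _
    have hd : ∀ t, HasDerivAt (fun t => eexp (-k) t • U t)
        (Complex.I • ((-(2 * Real.pi * (k:ℝ))) • (eexp (-k) t • U t) +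
          eexp (-k) t • g t (Y t))) t := by
      intro t
      refine ((eexp_hasDerivAt (-k) t).smul (hUd t)).congr_deriv ?_
      ext i
      simp [w]
      ring
    have hinteg := intervalIntegral.integral_eq_sub_of_hasDerivAt (a := (0:ℝ)) (b := 1)
      (fun t _ => hd t)
      (by
        apply Continuous.intervalIntegrable
        exact (((hec.smul hUc).const_smul (-(2 * Real.pi * (k:ℝ)))).add
          (hec.smul hgYc)).const_smul Complex.I)
    rw [hU0, hU1, smul_zero, smul_zero, sub_zero, intervalIntegral.integral_smul,
      intervalIntegral.integral_add hUi2 hgi, intervalIntegral.integral_smul] at hinteg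
    have hinteg2 := (smul_eq_zero.1 hinteg).resolve_left Complex.I_ne_zero
    have e1 : (-(2 * Real.pi * (k:ℝ))) • (∫ t in (0:ℝ)..1, eexp (-k) t • Y t) =
        (-(2 * Real.pi * (k:ℝ))) • (∫ t in (0:ℝ)..1, eexp (-k) t • U t) :=
      add_right_cancel ((hY k).trans hinteg2.symm)
    have hk' : (-(2 * Real.pi * (k:ℝ))) ≠ 0 := by
      have : (k:ℝ) ≠ 0 := by exact_mod_cast hk
      have := Real.pi_ne_zero
      simp [*]
    have e2 := smul_right_injective (Esp n) hk' e1
    simp only [smul_sub]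
    rw [intervalIntegral.integral_sub hYi hUi]
    exact sub_eq_zero.2 e2
  have hconst : ∀ t, Y t - U t = Y 0 - U 0 := by
    intro t
    ext i
    refine fourier_const (fun t => (Y t - U t) i) ?_ ?_ ?_ t
    · exact (EuclideanSpace.proj (𝕜 := ℂ) i).continuous.comp (hYc.sub hUc)
    · intro t; simp only [hYp, hUp]
    · intro k hk
      have h1 := (EuclideanSpace.proj (𝕜 := ℂ) i : Esp n →L[ℂ] ℂ).intervalIntegral_comp_comm
        (((eexp_continuous (-k)).smul (hYc.sub hUc)).intervalIntegrable
          (μ := MeasureTheory.volume) 0 1)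
      have h2 := hcoef k hk
      have h3 : (∫ t in (0:ℝ)..1, eexp (-k) t * (Y t - U t) i) =
        (EuclideanSpace.proj (𝕜 := ℂ) i : Esp n →L[ℂ] ℂ)
          (∫ t in (0:ℝ)..1, eexp (-k) t • (Y t - U t)) := by
        exact h1
      rw [h3, h2, map_zero]
  have hYU : Y = fun t => (Y 0 - U 0) + U t := by
    funext t
    rw [← hconst t]; abel
  rw [hYU]
  have := (hUd t).const_add (Y 0 - U 0)
  refine this.congr_deriv ?_
  show Complex.I • g t (Y t) = _
  congr 2
  exact congrFun hYU t

theorem stmt_aux (n : ℕ) (R : ℝ) (hR : 0 < R)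
    (H : ℝ → Esp n → ℝ)
    (hsm : ContDiff ℝ (⊤ : ℕ∞) (fun p : ℝ × Esp n => H p.1 p.2))
    (hper : ∀ t x, H (t + 1) x = H t x)
    (hnonneg : ∀ t x, 0 ≤ H t x)
    (hsupp : ∃ K : Set (Esp n), IsCompact K ∧ K ⊆ ball (0 : Esp n) R ∧
      ∀ t, ∀ x ∉ K, H t x = 0)
    (h0 : ∀ t, 0 < H t 0) :
    ∃ γ : ℝ → Esp n,
      (∀ t, HasDerivAt γ (Complex.I • gradient (H t) (γ t)) t) ∧
      (∀ t, γ (t + 1) = γ t) ∧ 0 < action H γ := by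
  obtain ⟨g, hg, hg1, hgrad, hgp, hfar, ⟨C, hC0, hC⟩, ⟨M, hM0, hM⟩, ⟨L, hL0, hL⟩, β, hβ0, hβ⟩ :=
    aux_ham R hR H hsm hper hnonneg hsupp h0
  have hsm1 : ContDiff ℝ 1 (fun p : ℝ × Esp n => H p.1 p.2) :=
    hsm.of_le (by exact_mod_cast le_top)
  obtain ⟨Y, hYc, hYp, hY, hact⟩ := weak_orbit R hR H g hsm1 hnonneg hg1 hgrad hfar M hM0 hM
    L hL0 hL C hC0 hC β hβ0 hβ
  have hder := strong_orbit g hg1.continuous hgp Y hYc hYp hY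
  refine ⟨Y, fun t => ?_, hYp, ?_⟩
  · rw [← hg]; exact hder t
  · refine hβ0.trans_le (hact.trans (le_of_eq ?_))
    unfold action
    congr 2
    refine intervalIntegral.integral_congr fun t _ => ?_
    show ⟪g t (Y t), Y t⟫ = ⟪(Complex.I • Y t : Esp n), deriv Y t⟫
    rw [(hder t).deriv, aux_inner_J, real_inner_comm]

/-- **Theorem 3.1 of Ginzburg–Gürel for `W = ℝ^{2n}`, `M = {0}`**: a smooth
`1`-periodic-in-time, nonnegative Hamiltonian `H`, supported (in `x`,
uniformly in `t`) in a fixed compact subset of the ball `B_R`, and positive at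
the origin for all times, has a `1`-periodic orbit with positive action. -/
theorem stmt_17 (n : ℕ) (hn : 1 ≤ n) (R : ℝ) (hR : 0 < R)
    (H : ℝ → Esp n → ℝ)
    (hsm : ContDiff ℝ (⊤ : ℕ∞) (fun p : ℝ × Esp n => H p.1 p.2))
    (hper : ∀ t x, H (t + 1) x = H t x)
    (hnonneg : ∀ t x, 0 ≤ H t x)
    (hsupp : ∃ K : Set (Esp n), IsCompact K ∧ K ⊆ ball (0 : Esp n) R ∧
      ∀ t, ∀ x ∉ K, H t x = 0)
    (h0 : ∀ t, 0 < H t 0) :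
    ∃ γ : ℝ → Esp n,
      (∀ t, HasDerivAt γ (Complex.I • gradient (H t) (γ t)) t) ∧
      (∀ t, γ (t + 1) = γ t) ∧ 0 < action H γ := by
  exact stmt_aux n R hR H hsm hper hnonneg hsupp h0
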